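/- Let ω ∈ (0, π/2] and d_0 > 0. Then there exists a constant Θ > 0, depending only on d_0 and sin ω, with the following property. Let r > 0 and let X = (x¹,x²,x³,x⁴) : B → ℝ⁴ be a harmonic (ΔX = 0) C² conformally parametrized immersion with area element W, continuous up to the closure of B, such that: the plane mapping w ↦ (x¹(w), x²(w)) is injective on B with everywhere positive Jacobian determinant and x³, x⁴ are C² functions of (x¹,x²); X(0,0) = 0 and every continuous, piecewise C¹ curve γ : [0,1] → closure(B) with γ(0) = (0,0) and |γ(1)| = 1 satisfies ∫₀¹ |(d/dt)(X∘γ)(t)| dt ≥ r; ∬_B |∇X|² du dv ≤ d_0 r²; and every unit vector N ∈ ℝ⁴ orthogonal to X_u(w) and X_v(w) satisfies |N·e_1| ≤ cos ω for every w ∈ B. Then for every unit vector N orthogonal to X_u(0,0) and X_v(0,0), the quantity K = ((X_uu(0,0)·N)(X_vv(0,0)·N) − (X_uv(0,0)·N)²)/W(0,0)² satisfies −2K ≤ Θ/r²; in particular the principal curvatures at the center satisfy κ_1² + κ_2² ≤ Θ/r², a bound independent of r. -/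

import Mathlib

open scoped RealInnerProductSpace
open Metric Real

noncomputable section

abbrev E2 : Type := EuclideanSpace ℝ (Fin 2)
abbrev E4 : Type := EuclideanSpace ℝ (Fin 4)

/-- Partial derivative of a map `X : ℝ² → ℝ⁴` in the `i`-th coordinate direction. -/
def pd (X : E2 → E4) (i : Fin 2) (w : E2) : E4 :=
  fderiv ℝ X w (EuclideanSpace.single i 1)

/-- Second partial derivative `X_{uⁱ uʲ}`. -/
def pd2 (X : E2 → E4) (i j : Fin 2) (w : E2) : E4 :=
  pd (pd X i) j w

/-- Partial derivative of a scalar function on `ℝ²`. -/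
def pdR (f : E2 → ℝ) (i : Fin 2) (w : E2) : ℝ :=
  fderiv ℝ f w (EuclideanSpace.single i 1)

/-- **Harnack inequality** for `log (M / ‖f‖)`, where `f` is a zero-free holomorphic function
bounded by `M` on a disc. -/
lemma log_div_norm_zero_le_of_norm_lt {f : ℂ → ℂ} {R M : ℝ} {z : ℂ} (hR : 0 < R) (hM : 0 < M)
    (hf : DifferentiableOn ℂ f (ball 0 R)) (hf0 : ∀ w ∈ ball (0 : ℂ) R, f w ≠ 0)
    (hfM : ∀ w ∈ ball (0 : ℂ) R, ‖f w‖ < M) (hz : z ∈ ball (0 : ℂ) R) :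
    Real.log (M / ‖f 0‖) ≤ Real.log (M / ‖f z‖) * (R + ‖z‖) / (R - ‖z‖) := by
  have h0 : (0 : ℂ) ∈ ball (0 : ℂ) R := mem_ball_self hR
  have hzR : ‖z‖ < R := by simpa using hz
  have hdiv : DifferentiableOn ℂ (fun w => deriv f w / f w) (ball 0 R) :=
    (hf.deriv isOpen_ball).div hf hf0
  obtain ⟨L, hLz, hL⟩ := hdiv.isExactOn_ball.with_val_at z (Real.log (‖f z‖ / M) : ℂ)
  have hder : ∀ w ∈ ball (0 : ℂ) R,
      HasDerivAt (fun w => f w * Complex.exp (-L w)) 0 w := by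
    intro w hw
    have h1 : HasDerivAt f (deriv f w) w :=
      (hf.differentiableAt (isOpen_ball.mem_nhds hw)).hasDerivAt
    have hw0 := hf0 w hw
    refine (h1.mul (hL w hw).neg.cexp).congr_deriv ?_
    simp only [Pi.neg_apply]
    field_simp
    ring
  have hconst : ∀ w ∈ ball (0 : ℂ) R,
      f w * Complex.exp (-L w) = f z * Complex.exp (-L z) := by
    intro w hw
    refine (convex_ball (0 : ℂ) R).is_const_of_fderivWithin_eq_zero (𝕜 := ℂ)
      (fun w hw => (hder w hw).differentiableAt.differentiableWithinAt) ?_ hw hz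
    intro w hw
    rw [fderivWithin_of_isOpen isOpen_ball hw]
    ext
    simp [(hder w hw).hasFDerivAt.fderiv]
  have hre : ∀ w ∈ ball (0 : ℂ) R, (L w).re = Real.log (‖f w‖ / M) := by
    intro w hw
    have h1 := congrArg norm (hconst w hw)
    have hw0 : 0 < ‖f w‖ := norm_pos_iff.2 (hf0 w hw)
    have hz0 : 0 < ‖f z‖ := norm_pos_iff.2 (hf0 z hz)
    rw [norm_mul, norm_mul, Complex.norm_exp, Complex.norm_exp, hLz] at h1
    rw [Complex.neg_re, Complex.neg_re, Complex.ofReal_re, Real.exp_neg, Real.exp_neg,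
      Real.exp_log (by positivity)] at h1
    have h2 : Real.exp (L w).re = ‖f w‖ / M := by
      field_simp at h1 ⊢
      linarith
    rw [← h2, Real.log_exp]
  have hneg : ∀ w ∈ ball (0 : ℂ) R, (L w).re < 0 := by
    intro w hw
    rw [hre w hw]
    have hw0 : 0 < ‖f w‖ := norm_pos_iff.2 (hf0 w hw)
    exact Real.log_neg (by positivity) ((div_lt_one hM).2 (hfM w hw))
  have hne : ∀ w ∈ ball (0 : ℂ) R, L w ≠ 0 := by
    intro w hw h
    have := hneg w hw
    simp [h] at this
  have hinv : DifferentiableOn ℂ (fun w => (L w)⁻¹) (ball 0 R) :=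
    DifferentiableOn.inv (fun w hw => (hL w hw).differentiableAt.differentiableWithinAt) hne
  have hbc : ‖(L z)⁻¹‖ ≤ ‖(L 0)⁻¹‖ * (R + ‖z‖) / (R - ‖z‖) := by
    have hlim : Filter.Tendsto
        (fun ε : ℝ => 2 * ε * ‖z‖ / (R - ‖z‖) + ‖(L 0)⁻¹‖ * (R + ‖z‖) / (R - ‖z‖))
        (nhdsWithin 0 (Set.Ioi 0))
        (nhds (2 * 0 * ‖z‖ / (R - ‖z‖) + ‖(L 0)⁻¹‖ * (R + ‖z‖) / (R - ‖z‖))) :=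
      Filter.Tendsto.mono_left (Continuous.tendsto (by fun_prop) 0) nhdsWithin_le_nhds
    have := ge_of_tendsto hlim (b := ‖(L z)⁻¹‖) (by
      filter_upwards [self_mem_nhdsWithin] with ε hε
      refine Complex.borelCaratheodory hε hinv ?_ hR hz
      intro w hw
      simp only [Set.mem_ofPred_eq, Complex.inv_re]
      exact (div_nonpos_of_nonpos_of_nonneg (hneg w hw).le (Complex.normSq_nonneg _)).trans
        (le_of_lt hε))
    simpa using this
  have hz0 : 0 < ‖f z‖ := norm_pos_iff.2 (hf0 z hz)
  have h00 : 0 < ‖f 0‖ := norm_pos_iff.2 (hf0 0 h0)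
  have hnz : ‖L z‖ = Real.log (M / ‖f z‖) := by
    have := hneg z hz
    rw [hLz, Complex.ofReal_re] at this
    rw [hLz, Complex.norm_real, Real.norm_of_nonpos this.le, ← Real.log_inv, inv_div]
  have hn0 : Real.log (M / ‖f 0‖) ≤ ‖L 0‖ := by
    rw [← inv_div, Real.log_inv, ← hre 0 h0]
    exact (neg_le_abs _).trans (Complex.abs_re_le_norm _)
  refine hn0.trans ?_
  rw [← hnz]
  have hp0 : 0 < ‖L 0‖ := norm_pos_iff.2 (hne 0 h0)
  have hpz : 0 < ‖L z‖ := norm_pos_iff.2 (hne z hz)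
  have hd : 0 < R - ‖z‖ := by linarith
  rw [norm_inv, norm_inv, le_div_iff₀ hd] at hbc
  rw [le_div_iff₀ hd]
  field_simp at hbc
  linarith

/-- Integration over a disc in polar coordinates. -/
lemma lintegral_ball_polar (z : ℂ) (d : ℝ) (F : ℂ → ENNReal) :
    ∫⁻ w in ball z d, F w =
      ∫⁻ p in Set.Ioo 0 d ×ˢ Set.Ioo (-π) π, ENNReal.ofReal p.1 * F (circleMap z p.1 p.2) := by
  rw [← MeasureTheory.lintegral_indicator measurableSet_ball,
    ← MeasureTheory.lintegral_add_left_eq_self _ z, ← Complex.lintegral_comp_polarCoord_symm,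
    polarCoord_target,
    ← MeasureTheory.lintegral_indicator (measurableSet_Ioi.prod measurableSet_Ioo),
    ← MeasureTheory.lintegral_indicator (measurableSet_Ioo.prod measurableSet_Ioo)]
  congr 1 with p
  have hc : z + (p.1 : ℂ) * (↑(cos p.2) + ↑(sin p.2) * Complex.I) = circleMap z p.1 p.2 := by
    rw [circleMap, Complex.exp_mul_I, Complex.ofReal_cos, Complex.ofReal_sin]
  have hm : circleMap z p.1 p.2 ∈ ball z d ↔ |p.1| < d := by simp [circleMap]
  by_cases h1 : 0 < p.1
  · rw [abs_of_pos h1] at hm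
    by_cases h2 : p.2 ∈ Set.Ioo (-π) π
    · rw [Set.indicator_of_mem (by exact ⟨h1, h2⟩), Complex.polarCoord_symm_apply, hc, smul_eq_mul]
      by_cases h3 : p.1 < d
      · rw [Set.indicator_of_mem (hm.2 h3), Set.indicator_of_mem (by exact ⟨⟨h1, h3⟩, h2⟩)]
      · rw [Set.indicator_of_notMem (a := p) (fun h => h3 h.1.2),
          Set.indicator_of_notMem (fun h => h3 (hm.1 h)), mul_zero]
    · rw [Set.indicator_of_notMem (fun h => h2 h.2), Set.indicator_of_notMem (fun h => h2 h.2)]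
  · rw [Set.indicator_of_notMem (fun h => h1 h.1), Set.indicator_of_notMem (fun h => h1 h.1.1)]

lemma aemeasurable_polar {d : ℝ} {z : ℂ} {g : ℂ → ℝ} (hg : ContinuousOn g (ball z d)) :
    AEMeasurable (fun p : ℝ × ℝ => ENNReal.ofReal (g (circleMap z p.1 p.2)))
      (MeasureTheory.volume.restrict (Set.Ioo 0 d ×ˢ Set.Ioo (-π) π)) := by
  refine AEMeasurable.ennreal_ofReal (ContinuousOn.aemeasurable ?_
    (measurableSet_Ioo.prod measurableSet_Ioo))
  refine hg.comp (by unfold circleMap; fun_prop) ?_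
  rintro p ⟨⟨h1, h2⟩, -⟩
  simpa [circleMap, abs_of_pos h1] using h2

/-- Interior estimate for a holomorphic function in terms of its `L²` norm. -/
lemma norm_sq_mul_le_lintegral_ball {f : ℂ → ℂ} {z : ℂ} {d : ℝ} (hd : 0 < d)
    (hf : DifferentiableOn ℂ f (ball z d)) :
    ENNReal.ofReal (‖f z‖ ^ 2 * d ^ 2) ≤ ∫⁻ w in ball z d, ENNReal.ofReal (‖f w‖ ^ 2) := by
  have hmean : ∀ ρ ∈ Set.Ioo 0 d, ENNReal.ofReal (2 * π * ‖f z‖ ^ 2) ≤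
      ∫⁻ θ in Set.Ioo (-π) π, ENNReal.ofReal (‖f (circleMap z ρ θ)‖ ^ 2) := by
    rintro ρ ⟨h0, h1⟩
    have hsub : closedBall z |ρ| ⊆ ball z d := by
      rw [abs_of_pos h0]; exact closedBall_subset_ball h1
    have hdc : DiffContOnCl ℂ (fun w => f w ^ 2) (ball z |ρ|) :=
      (DifferentiableOn.pow (hf.mono (hsub.trans' (closure_ball_subset_closedBall))) 2).diffContOnCl
    have hcont : Continuous fun θ => f (circleMap z ρ θ) :=
      hf.continuousOn.comp_continuous (continuous_circleMap z ρ) fun θ => hsub <| by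
        simp [circleMap]
    have h2 := hdc.circleAverage
    have h3 : 2 * π * ‖f z‖ ^ 2 ≤ ∫ θ in (-π)..π, ‖f (circleMap z ρ θ)‖ ^ 2 := by
      have hper : Function.Periodic (fun θ => f (circleMap z ρ θ) ^ 2) (2 * π) := fun θ => by
        simp [periodic_circleMap z ρ θ]
      have h4 := hper.intervalIntegral_add_eq 0 (-π)
      rw [zero_add, show -π + 2 * π = π by ring] at h4
      rw [Real.circleAverage, h4] at h2
      have h5 : 2 * π * ‖f z‖ ^ 2 = ‖∫ θ in (-π)..π, f (circleMap z ρ θ) ^ 2‖ := by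
        rw [← norm_pow, ← h2, norm_smul, Real.norm_of_nonneg (by positivity)]
        field_simp
      rw [h5]
      refine (intervalIntegral.norm_integral_le_integral_norm (by linarith [pi_pos])).trans ?_
      simp
    refine (ENNReal.ofReal_le_ofReal h3).trans ?_
    rw [intervalIntegral.integral_of_le (by linarith [pi_pos]),
      MeasureTheory.integral_Ioc_eq_integral_Ioo,
      MeasureTheory.ofReal_integral_eq_lintegral_ofReal]
    · exact ((hcont.norm.pow 2).integrableOn_Icc (a := -π) (b := π)).mono_set
        Set.Ioo_subset_Icc_self
    · exact Filter.Eventually.of_forall fun _ => by positivity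
  rw [lintegral_ball_polar, MeasureTheory.Measure.volume_eq_prod,
    ← MeasureTheory.Measure.prod_restrict, MeasureTheory.lintegral_prod]
  · have h1 : ∫⁻ ρ in Set.Ioo 0 d, ENNReal.ofReal ρ * ENNReal.ofReal (2 * π * ‖f z‖ ^ 2)
        = ENNReal.ofReal (π * ‖f z‖ ^ 2 * d ^ 2) := by
      have : ∫ ρ in (0 : ℝ)..d, ρ * (2 * π * ‖f z‖ ^ 2) = π * ‖f z‖ ^ 2 * d ^ 2 := by
        rw [intervalIntegral.integral_mul_const, integral_id]; ring
      rw [← this, intervalIntegral.integral_of_le hd.le,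
        MeasureTheory.integral_Ioc_eq_integral_Ioo,
        MeasureTheory.ofReal_integral_eq_lintegral_ofReal]
      · refine MeasureTheory.setLIntegral_congr_fun measurableSet_Ioo fun ρ hρ => ?_
        rw [ENNReal.ofReal_mul hρ.1.le]
      · exact (Continuous.integrableOn_Icc (by fun_prop)).mono_set Set.Ioo_subset_Icc_self
      · filter_upwards [MeasureTheory.ae_restrict_mem measurableSet_Ioo] with ρ hρ
        have := hρ.1
        simp only [Pi.zero_apply]
        positivity
    calc ENNReal.ofReal (‖f z‖ ^ 2 * d ^ 2) ≤ ENNReal.ofReal (π * ‖f z‖ ^ 2 * d ^ 2) := by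
          apply ENNReal.ofReal_le_ofReal
          have := pi_gt_three
          nlinarith [mul_nonneg (sq_nonneg ‖f z‖) (sq_nonneg d)]
      _ = _ := h1.symm
      _ ≤ _ := by
          refine MeasureTheory.setLIntegral_mono' measurableSet_Ioo fun ρ hρ => ?_
          rw [MeasureTheory.lintegral_const_mul' _ _ ENNReal.ofReal_ne_top]
          gcongr
          exact hmean ρ hρ
  · rw [MeasureTheory.Measure.prod_restrict, ← MeasureTheory.Measure.volume_eq_prod]
    exact (by fun_prop : Measurable fun p : ℝ × ℝ => ENNReal.ofReal p.1).aemeasurable.mul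
      (aemeasurable_polar (hf.continuousOn.norm.pow 2))

/-- If the length element `G |dz|` on the unit disc has energy at most `d₀ r²`, and all radii have
length at least `r`, then `G` is at least `r / 2` somewhere on a fixed smaller disc. -/
lemma exists_half_le_of_radial_length {d₀ δ r : ℝ} {G : ℂ → ℝ} (hδ : 0 < δ) (hδ2 : δ ≤ 1 / 2)
    (hδd : δ * d₀ ≤ 1 / 2) (hr : 0 < r) (hG : ContinuousOn G (ball 0 1))
    (hE : ∫⁻ w in ball (0 : ℂ) 1, ENNReal.ofReal (G w ^ 2) ≤ ENNReal.ofReal (d₀ * r ^ 2))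
    (hL : ∀ θ : ℝ, ENNReal.ofReal r ≤
      ∫⁻ ρ in Set.Ioo (0 : ℝ) 1, ENNReal.ofReal (G (circleMap 0 ρ θ))) :
    ∃ z : ℂ, ‖z‖ ≤ 1 - δ ∧ r / 2 ≤ G z := by
  by_contra! hcon
  have hmeas : ∀ θ, AEMeasurable (fun ρ => ENNReal.ofReal (G (circleMap 0 ρ θ) ^ 2))
      (MeasureTheory.volume.restrict (Set.Ioo (0 : ℝ) 1)) := by
    intro θ
    refine AEMeasurable.ennreal_ofReal (ContinuousOn.aemeasurable ?_ measurableSet_Ioo)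
    refine (hG.pow 2).comp (f := fun ρ : ℝ => circleMap 0 ρ θ) (by unfold circleMap; fun_prop) ?_
    rintro ρ ⟨h1, h2⟩
    simpa [circleMap, abs_of_pos h1] using h2
  have hmeas' : ∀ θ, AEMeasurable
      (fun ρ => ENNReal.ofReal ρ * ENNReal.ofReal (G (circleMap 0 ρ θ) ^ 2))
      (MeasureTheory.volume.restrict (Set.Ioo (0 : ℝ) 1)) := fun θ =>
    (by fun_prop : Measurable fun ρ : ℝ => ENNReal.ofReal ρ).aemeasurable.mul (hmeas θ)
  have hray : ∀ θ : ℝ, ENNReal.ofReal (r / 4) ≤ ENNReal.ofReal (2 * δ / r) *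
      ∫⁻ ρ in Set.Ioo (0 : ℝ) 1,
        ENNReal.ofReal ρ * ENNReal.ofReal (G (circleMap 0 ρ θ) ^ 2) := by
    intro θ
    have hpt : ∀ ρ ∈ Set.Ioo (0 : ℝ) 1, ENNReal.ofReal (G (circleMap 0 ρ θ)) ≤
        (ENNReal.ofReal (r / 2) +
          (Set.Ioo (1 - δ) 1).indicator (fun _ => ENNReal.ofReal (r / (4 * δ))) ρ) +
        ENNReal.ofReal (2 * δ / r) *
          (ENNReal.ofReal ρ * ENNReal.ofReal (G (circleMap 0 ρ θ) ^ 2)) := by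
      rintro ρ ⟨h0, h1⟩
      by_cases h : ρ ≤ 1 - δ
      · rw [add_assoc]
        refine le_add_right (ENNReal.ofReal_le_ofReal ?_)
        exact (hcon _ (by simpa [circleMap, abs_of_pos h0] using h)).le
      · push Not at h
        rw [Set.indicator_of_mem (by exact ⟨h, h1⟩), ← ENNReal.ofReal_mul h0.le,
          ← ENNReal.ofReal_mul (by positivity), ← ENNReal.ofReal_add (by positivity) (by positivity),
          ← ENNReal.ofReal_add (by positivity) (by positivity)]
        refine ENNReal.ofReal_le_ofReal ?_
        set g := G (circleMap 0 ρ θ)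
        have h2 : 1 / 2 ≤ ρ := by linarith
        have h3 : δ / r * g ^ 2 ≤ 2 * δ / r * (ρ * g ^ 2) := by
          have : 0 ≤ δ / r * g ^ 2 := by positivity
          have e : 2 * δ / r * (ρ * g ^ 2) = δ / r * g ^ 2 * (2 * ρ) := by ring
          rw [e]
          nlinarith
        have h4 : g ≤ r / (4 * δ) + δ / r * g ^ 2 := by
          have e : r / (4 * δ) + δ / r * g ^ 2 - g = δ / r * (g - r / (2 * δ)) ^ 2 := by
            field_simp
            ring
          have : 0 ≤ δ / r * (g - r / (2 * δ)) ^ 2 := by positivity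
          linarith
        linarith
    have h1 := (hL θ).trans (MeasureTheory.setLIntegral_mono' measurableSet_Ioo hpt)
    rw [MeasureTheory.lintegral_add_left (by measurability),
      MeasureTheory.lintegral_add_left measurable_const,
      MeasureTheory.lintegral_const_mul' _ _ ENNReal.ofReal_ne_top,
      MeasureTheory.lintegral_indicator measurableSet_Ioo,
      MeasureTheory.Measure.restrict_restrict measurableSet_Ioo,
      MeasureTheory.setLIntegral_const, MeasureTheory.setLIntegral_const,
      Set.inter_eq_self_of_subset_left (Set.Ioo_subset_Ioo_left (by linarith)),
      Real.volume_Ioo, Real.volume_Ioo, ← ENNReal.ofReal_mul (by positivity),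
      ← ENNReal.ofReal_mul (by positivity), ← ENNReal.ofReal_add (by positivity)
        (by have : 0 ≤ 1 - (1 - δ) := by linarith
            positivity),
      show r / 2 * (1 - 0) + r / (4 * δ) * (1 - (1 - δ)) = 3 * r / 4 by field_simp; ring,
      show r = 3 * r / 4 + r / 4 by ring, ENNReal.ofReal_add (by positivity) (by positivity)] at h1
    rw [show 3 * (3 * r / 4 + r / 4) / 4 = 3 * r / 4 by ring,
      show 3 * r / 4 + r / 4 = r by ring] at h1
    exact (ENNReal.add_le_add_iff_left ENNReal.ofReal_ne_top).1 h1
  have htot : ENNReal.ofReal (r / 4) * ENNReal.ofReal (2 * π) ≤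
      ENNReal.ofReal (2 * δ / r) * ENNReal.ofReal (d₀ * r ^ 2) := by
    refine le_trans ?_ (mul_le_mul_right hE _)
    rw [lintegral_ball_polar, MeasureTheory.Measure.volume_eq_prod,
      ← MeasureTheory.Measure.prod_restrict, MeasureTheory.lintegral_prod_symm,
      ← MeasureTheory.lintegral_const_mul' _ _ ENNReal.ofReal_ne_top]
    · refine le_trans (le_of_eq ?_)
        (MeasureTheory.setLIntegral_mono' measurableSet_Ioo fun θ _ => hray θ)
      rw [MeasureTheory.setLIntegral_const, Real.volume_Ioo]
      congr 2
      ring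
    · rw [MeasureTheory.Measure.prod_restrict, ← MeasureTheory.Measure.volume_eq_prod]
      exact (by fun_prop : Measurable fun p : ℝ × ℝ => ENNReal.ofReal p.1).aemeasurable.mul
        (aemeasurable_polar (hG.pow 2))
  rw [← ENNReal.ofReal_mul (by positivity), ← ENNReal.ofReal_mul (by positivity)] at htot
  have h1 : r / 4 * (2 * π) ≤ max (2 * δ / r * (d₀ * r ^ 2)) 0 := by
    by_contra! h
    rw [max_lt_iff] at h
    exact absurd htot (not_le.2 ((ENNReal.ofReal_lt_ofReal_iff h.2).2 h.1))
  have h2 : 2 * δ / r * (d₀ * r ^ 2) = 2 * (δ * d₀) * r := by field_simp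
  have h3 : max (2 * δ / r * (d₀ * r ^ 2)) 0 ≤ r := by
    rw [h2]
    exact max_le (by nlinarith) hr.le
  nlinarith [pi_gt_three]

/-- Lower bound at the center for a zero-free holomorphic function `f` that is comparable to a
length element `G` of bounded energy for which all radii are long. -/
lemma exists_mul_le_norm_zero {d₀ s : ℝ} (hd₀ : 0 < d₀) (hs : 0 < s) :
    ∃ c : ℝ, 0 < c ∧ ∀ (r : ℝ), 0 < r → ∀ (f : ℂ → ℂ) (G : ℂ → ℝ),
      DifferentiableOn ℂ f (ball 0 1) → (∀ w ∈ ball (0 : ℂ) 1, f w ≠ 0) →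
      ContinuousOn G (ball 0 1) →
      (∀ w ∈ ball (0 : ℂ) 1, s * G w ≤ ‖f w‖ ∧ ‖f w‖ ≤ G w) →
      ∫⁻ w in ball (0 : ℂ) 1, ENNReal.ofReal (G w ^ 2) ≤ ENNReal.ofReal (d₀ * r ^ 2) →
      (∀ θ : ℝ, ENNReal.ofReal r ≤
        ∫⁻ ρ in Set.Ioo (0 : ℝ) 1, ENNReal.ofReal (G (circleMap 0 ρ θ))) →
      c * r ≤ ‖f 0‖ := by
  obtain ⟨δ, hδ, hδ2, hδd⟩ : ∃ δ : ℝ, 0 < δ ∧ δ ≤ 1 / 2 ∧ δ * d₀ ≤ 1 / 2 := by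
    refine ⟨min (1 / 2) (1 / (2 * d₀)), by positivity, min_le_left _ _, ?_⟩
    calc min (1 / 2) (1 / (2 * d₀)) * d₀ ≤ 1 / (2 * d₀) * d₀ := by
          gcongr; exact min_le_right _ _
      _ = 1 / 2 := by field_simp
  set m : ℝ := 4 * √d₀ / δ with hm
  have hsd : 0 < √d₀ := Real.sqrt_pos.2 hd₀
  have hmpos : 0 < m := by positivity
  refine ⟨m * Real.exp (-(Real.log (2 * m / s) * (4 / δ))), by positivity, ?_⟩
  intro r hr f G hf hf0 hG hfG hE hL
  obtain ⟨z, hz, hGz⟩ := exists_half_le_of_radial_length hδ hδ2 hδd hr hG hE hL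
  have hfM : ∀ w ∈ ball (0 : ℂ) (1 - δ / 2), ‖f w‖ < m * r := by
    intro w hw
    have hsub : ball w (δ / 2) ⊆ ball (0 : ℂ) 1 := by
      refine ball_subset_ball' ?_
      rw [mem_ball] at hw
      linarith
    have h1 := norm_sq_mul_le_lintegral_ball (half_pos hδ) (hf.mono hsub)
    have h2 : ∫⁻ w in ball w (δ / 2), ENNReal.ofReal (‖f w‖ ^ 2) ≤
        ENNReal.ofReal (d₀ * r ^ 2) := by
      refine le_trans ?_ hE
      refine (MeasureTheory.lintegral_mono_set hsub).trans ?_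
      refine MeasureTheory.setLIntegral_mono' measurableSet_ball fun v hv => ?_
      refine ENNReal.ofReal_le_ofReal ?_
      gcongr
      exact (hfG v hv).2
    have h3 := (ENNReal.ofReal_le_ofReal_iff (by positivity)).1 (h1.trans h2)
    refine lt_of_pow_lt_pow_left₀ 2 (by positivity) ?_
    have h4 : (m * r) ^ 2 * (δ / 2) ^ 2 = 4 * (d₀ * r ^ 2) := by
      rw [hm]
      field_simp
      rw [Real.sq_sqrt hd₀.le]
      ring
    have h5 : 0 < d₀ * r ^ 2 := by positivity
    have h6 : 0 < (δ / 2) ^ 2 := by positivity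
    by_contra! h
    have := mul_le_mul_of_nonneg_right h h6.le
    linarith
  have hsub : ball (0 : ℂ) (1 - δ / 2) ⊆ ball 0 1 := ball_subset_ball (by linarith)
  have hzb : z ∈ ball (0 : ℂ) (1 - δ / 2) := by
    rw [mem_ball_zero_iff]; linarith
  have hH := log_div_norm_zero_le_of_norm_lt (by linarith) (by positivity : 0 < m * r)
    (hf.mono hsub) (fun w hw => hf0 w (hsub hw)) hfM hzb
  have hfz : s * (r / 2) ≤ ‖f z‖ :=
    (mul_le_mul_of_nonneg_left hGz hs.le).trans (hfG z (hsub hzb)).1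
  have hfzpos : 0 < ‖f z‖ := lt_of_lt_of_le (by positivity) hfz
  have hf0pos : 0 < ‖f 0‖ := norm_pos_iff.2 (hf0 0 (mem_ball_self one_pos))
  have hlog : Real.log (m * r / ‖f z‖) ≤ Real.log (2 * m / s) := by
    refine Real.log_le_log (by positivity) ?_
    rw [div_le_div_iff₀ hfzpos hs]
    nlinarith
  have hlog0 : 0 ≤ Real.log (m * r / ‖f z‖) :=
    Real.log_nonneg ((one_le_div hfzpos).2 (hfM z hzb).le)
  have hquot : (1 - δ / 2 + ‖z‖) / (1 - δ / 2 - ‖z‖) ≤ 4 / δ := by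
    rw [div_le_div_iff₀ (by linarith) hδ]
    nlinarith
  have hquot0 : 0 ≤ (1 - δ / 2 + ‖z‖) / (1 - δ / 2 - ‖z‖) :=
    div_nonneg (by linarith [norm_nonneg z]) (by linarith)
  rw [mul_div_assoc (Real.log (m * r / ‖f z‖))] at hH
  have h1 := hH.trans (mul_le_mul hlog hquot hquot0 (hlog0.trans hlog))
  rw [Real.log_le_iff_le_exp (by positivity), div_le_iff₀ hf0pos] at h1
  rw [Real.exp_neg]
  have hexp := Real.exp_pos (Real.log (2 * m / s) * (4 / δ))
  calc m * (Real.exp (Real.log (2 * m / s) * (4 / δ)))⁻¹ * r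
      = m * r / Real.exp (Real.log (2 * m / s) * (4 / δ)) := by ring
    _ ≤ ‖f 0‖ := by rw [div_le_iff₀ hexp]; linarith

/-- A smooth cutoff function on `[0, 3/4]`, equal to `1` on `[1/4, 1/2]`. -/
def wiggleCutoff (s : ℝ) : ℝ :=
  smoothTransition (4 * s) * smoothTransition (3 - 4 * s)

lemma wiggleCutoff_of_le {s : ℝ} (hs : s ≤ 0) : wiggleCutoff s = 0 := by
  rw [wiggleCutoff, smoothTransition.zero_of_nonpos (by linarith), zero_mul]

lemma wiggleCutoff_of_ge {s : ℝ} (hs : 3 / 4 ≤ s) : wiggleCutoff s = 0 := by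
  rw [wiggleCutoff, smoothTransition.zero_of_nonpos (x := 3 - 4 * s) (by linarith), mul_zero]

lemma wiggleCutoff_of_mem {s : ℝ} (hs : s ∈ Set.Icc (1 / 4 : ℝ) (1 / 2)) : wiggleCutoff s = 1 := by
  rw [wiggleCutoff, smoothTransition.one_of_one_le (by linarith [hs.1]),
    smoothTransition.one_of_one_le (by linarith [hs.2]), one_mul]

lemma abs_wiggleCutoff_le (s : ℝ) : |wiggleCutoff s| ≤ 1 := by
  rw [wiggleCutoff, abs_of_nonneg (mul_nonneg (smoothTransition.nonneg _)
    (smoothTransition.nonneg _))]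
  exact mul_le_one₀ (smoothTransition.le_one _) (smoothTransition.nonneg _)
    (smoothTransition.le_one _)

lemma contDiff_wiggleCutoff : ContDiff ℝ 1 wiggleCutoff := by
  unfold wiggleCutoff
  have h : ContDiff ℝ 1 smoothTransition := smoothTransition.contDiff (n := 1)
  exact (h.comp (by fun_prop)).mul (h.comp (by fun_prop))

lemma exists_norm_deriv_le_of_eq_const {f : ℝ → ℝ} (hf : ContDiff ℝ 1 f) {c₀ c₁ : ℝ}
    (h0 : ∀ x ≤ 0, f x = c₀) (h1 : ∀ x, 1 ≤ x → f x = c₁) : ∃ C, ∀ x, |deriv f x| ≤ C := by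
  have hcont : Continuous (deriv f) := hf.continuous_deriv le_rfl
  obtain ⟨C, hC⟩ := isCompact_Icc.exists_bound_of_continuousOn (s := Set.Icc (0 : ℝ) 1)
    hcont.continuousOn
  have hC0 : 0 ≤ C := (norm_nonneg _).trans (hC 0 (by simp))
  refine ⟨C, fun x => ?_⟩
  by_cases hx : x ∈ Set.Icc (0 : ℝ) 1
  · exact hC x hx
  · have : deriv f x = 0 := by
      rw [Set.mem_Icc, not_and_or, not_le, not_le] at hx
      rcases hx with hx | hx
      · have : f =ᶠ[nhds x] fun _ => c₀ := by
          filter_upwards [Iio_mem_nhds hx] with y hy using h0 y (le_of_lt hy)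
        rw [this.deriv_eq, deriv_const]
      · have : f =ᶠ[nhds x] fun _ => c₁ := by
          filter_upwards [Ioi_mem_nhds hx] with y hy using h1 y (le_of_lt hy)
        rw [this.deriv_eq, deriv_const]
    rw [this, abs_zero]
    exact hC0

/-- A step by `d` on `[3/4, 1]`, preceded by `k` oscillations of amplitude `a` in direction `e`. -/
def wiggleStep {E : Type*} [NormedAddCommGroup E] [NormedSpace ℝ E] (d e : E) (a k s : ℝ) : E :=
  smoothTransition (4 * s - 3) • d + (a * (wiggleCutoff s * sin (2 * π * k * s))) • e

section wiggleStep

variable {E : Type*} [NormedAddCommGroup E] [NormedSpace ℝ E] {d e : E} {a k s : ℝ}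

lemma wiggleStep_of_le (hs : s ≤ 0) : wiggleStep d e a k s = 0 := by
  rw [wiggleStep, wiggleCutoff_of_le hs, smoothTransition.zero_of_nonpos (by linarith)]
  simp

lemma wiggleStep_of_one_le (hs : 1 ≤ s) : wiggleStep d e a k s = d := by
  rw [wiggleStep, wiggleCutoff_of_ge (by linarith), smoothTransition.one_of_one_le (by linarith)]
  simp

lemma wiggleStep_of_le_three_quarters (hs : s ≤ 3 / 4) :
    wiggleStep d e a k s = (a * (wiggleCutoff s * sin (2 * π * k * s))) • e := by
  rw [wiggleStep, smoothTransition.zero_of_nonpos (by linarith)]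
  simp

lemma wiggleStep_of_three_quarters_le (hs : 3 / 4 ≤ s) :
    wiggleStep d e a k s = smoothTransition (4 * s - 3) • d := by
  rw [wiggleStep, wiggleCutoff_of_ge hs]
  simp

lemma wiggleStep_of_mem (hs : s ∈ Set.Icc (1 / 4 : ℝ) (1 / 2)) :
    wiggleStep d e a k s = (a * sin (2 * π * k * s)) • e := by
  rw [wiggleStep_of_le_three_quarters (by linarith [hs.2]), wiggleCutoff_of_mem hs, one_mul]

lemma norm_wiggle_le (ha : 0 ≤ a) (he : ‖e‖ = 1) :
    ‖(a * (wiggleCutoff s * sin (2 * π * k * s))) • e‖ ≤ a := by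
  rw [norm_smul, he, mul_one, Real.norm_eq_abs, abs_mul, abs_of_nonneg ha, abs_mul]
  exact mul_le_of_le_one_right ha
    (mul_le_one₀ (abs_wiggleCutoff_le s) (abs_nonneg _) (abs_sin_le_one _))

lemma norm_wiggleStep_le (ha : 0 ≤ a) (he : ‖e‖ = 1) : ‖wiggleStep d e a k s‖ ≤ ‖d‖ + a := by
  refine (norm_add_le _ _).trans (add_le_add ?_ (norm_wiggle_le ha he))
  rw [norm_smul, Real.norm_of_nonneg (smoothTransition.nonneg _)]
  exact mul_le_of_le_one_left (norm_nonneg _) (smoothTransition.le_one _)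

lemma contDiff_wiggleStep : ContDiff ℝ 1 (wiggleStep d e a k) := by
  have h : ContDiff ℝ 1 smoothTransition := smoothTransition.contDiff (n := 1)
  have h' := contDiff_wiggleCutoff
  unfold wiggleStep
  exact ((h.comp (by fun_prop)).smul contDiff_const).add
    ((contDiff_const.mul (h'.mul (by fun_prop))).smul contDiff_const)

end wiggleStep

lemma exists_norm_deriv_wiggleStep_le : ∃ C : ℝ, 0 < C ∧
    ∀ (d e : E2) (a k s : ℝ), 0 ≤ a → 1 ≤ k → ‖e‖ = 1 →
      ‖deriv (wiggleStep d e a k) s‖ ≤ C * (‖d‖ + a * k) := by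
  have hT : ContDiff ℝ 1 smoothTransition := smoothTransition.contDiff (n := 1)
  obtain ⟨C₁, hC₁⟩ := exists_norm_deriv_le_of_eq_const hT
    (fun x hx => smoothTransition.zero_of_nonpos hx) (fun x hx => smoothTransition.one_of_one_le hx)
  obtain ⟨C₂, hC₂⟩ := exists_norm_deriv_le_of_eq_const contDiff_wiggleCutoff
    (fun x hx => wiggleCutoff_of_le hx) (fun x hx => wiggleCutoff_of_ge (by linarith))
  have hC₁0 : 0 ≤ C₁ := (abs_nonneg _).trans (hC₁ 0)
  have hC₂0 : 0 ≤ C₂ := (abs_nonneg _).trans (hC₂ 0)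
  refine ⟨4 * C₁ + C₂ + 2 * π, by positivity, ?_⟩
  intro d e a k s ha hk he
  have h1 : HasDerivAt (fun s => smoothTransition (4 * s - 3))
      (deriv smoothTransition (4 * s - 3) * 4) s := by
    have := (hT.differentiable one_ne_zero (4 * s - 3)).hasDerivAt
    refine this.comp s (h := fun s => 4 * s - 3) ?_
    simpa using ((hasDerivAt_id s).const_mul 4).sub_const 3
  have h2 : HasDerivAt wiggleCutoff (deriv wiggleCutoff s) s :=
    (contDiff_wiggleCutoff.differentiable one_ne_zero s).hasDerivAt
  have h3 : HasDerivAt (fun s => sin (2 * π * k * s)) (cos (2 * π * k * s) * (2 * π * k)) s := by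
    refine (hasDerivAt_sin _).comp s (h := fun s => 2 * π * k * s) ?_
    simpa using (hasDerivAt_id s).const_mul (2 * π * k)
  have h4 : HasDerivAt (wiggleStep d e a k) ((deriv smoothTransition (4 * s - 3) * 4) • d +
      (a * (deriv wiggleCutoff s * sin (2 * π * k * s) +
        wiggleCutoff s * (cos (2 * π * k * s) * (2 * π * k)))) • e) s :=
    (h1.smul_const d).add (((h2.mul h3).const_mul a).smul_const e)
  rw [h4.deriv]
  have b1 : ‖(deriv smoothTransition (4 * s - 3) * 4) • d‖ ≤ C₁ * 4 * ‖d‖ := by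
    rw [norm_smul, norm_mul, Real.norm_eq_abs, Real.norm_of_nonneg (by norm_num : (0 : ℝ) ≤ 4)]
    gcongr
    exact hC₁ _
  have b2 : ‖(a * (deriv wiggleCutoff s * sin (2 * π * k * s) +
        wiggleCutoff s * (cos (2 * π * k * s) * (2 * π * k)))) • e‖ ≤
      a * (C₂ * 1 + 1 * (1 * (2 * π * k))) := by
    rw [norm_smul, he, mul_one, norm_mul, Real.norm_of_nonneg ha]
    gcongr
    refine (norm_add_le _ _).trans ?_
    rw [norm_mul, norm_mul, norm_mul, Real.norm_of_nonneg (by positivity : 0 ≤ 2 * π * k)]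
    gcongr
    · exact hC₂ _
    · exact abs_sin_le_one _
    · exact abs_wiggleCutoff_le _
    · exact abs_cos_le_one _
  refine (norm_add_le _ _).trans ((add_le_add b1 b2).trans ?_)
  have e1 : 0 ≤ a * (k - 1) := mul_nonneg ha (by linarith)
  have e2 : 0 ≤ C₂ * (a * (k - 1)) := mul_nonneg hC₂0 e1
  have e3 : 0 ≤ C₁ * (a * k) := mul_nonneg hC₁0 (mul_nonneg ha (by linarith))
  have e4 : 0 ≤ C₂ * ‖d‖ := by positivity
  have e5 : 0 ≤ π * ‖d‖ := by positivity
  nlinarith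

/-- A curve through the points `q n`, reaching `q n` at time `1 - 2⁻ⁿ` and then oscillating
`k n` times with amplitude `a n` before moving on. -/
def wiggleCurve (q : ℕ → E2) (a k : ℕ → ℝ) (t : ℝ) : E2 :=
  ∑' n, wiggleStep (q (n + 1) - q n) (EuclideanSpace.single 0 1) (a n) (k n)
    (2 ^ (n + 1) * (t - 1) + 2)

section wiggleCurve

variable {q : ℕ → E2} {a k : ℕ → ℝ}

lemma contDiff_wiggleCurve (hq : ∀ n, ‖q (n + 1) - q n‖ ≤ 2 * (1 / 8) ^ n) (ha : ∀ n, 0 ≤ a n)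
    (hk : ∀ n, 1 ≤ k n) (hak : ∀ n, a n * k n = (1 / 8) ^ n) :
    ContDiff ℝ 1 (wiggleCurve q a k) := by
  obtain ⟨C, hC, hCb⟩ := exists_norm_deriv_wiggleStep_le
  have he : ‖(EuclideanSpace.single 0 1 : E2)‖ = 1 := by simp
  have hcd : ∀ n, ContDiff ℝ 1 fun t : ℝ => wiggleStep (q (n + 1) - q n)
      (EuclideanSpace.single 0 1 : E2) (a n) (k n) (2 ^ (n + 1) * (t - 1) + 2) := fun n =>
    contDiff_wiggleStep.comp (by fun_prop)
  refine contDiff_tsum (N := 1) (v := fun j n => if j = 0 then 3 * (1 / 8) ^ n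
    else 6 * C * (1 / 4) ^ n) hcd ?_ ?_
  · intro j _
    by_cases hj : j = 0
    · simp only [hj, if_true]
      exact (summable_geometric_of_lt_one (by norm_num) (by norm_num)).mul_left _
    · simp only [hj, if_false]
      exact (summable_geometric_of_lt_one (by norm_num) (by norm_num)).mul_left _
  · intro j n t hj
    have hj1 : j ≤ 1 := by exact_mod_cast hj
    have han : a n ≤ (1 / 8) ^ n := by
      rw [← hak n]
      exact le_mul_of_one_le_right (ha n) (hk n)
    interval_cases j
    · simp only [if_true, norm_iteratedFDeriv_zero]
      refine (norm_wiggleStep_le (ha n) he).trans ?_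
      linarith [hq n]
    · simp only [one_ne_zero, if_false]
      rw [norm_iteratedFDeriv_eq_norm_iteratedDeriv, iteratedDeriv_one]
      have hd : HasDerivAt (fun t : ℝ => (2 : ℝ) ^ (n + 1) * (t - 1) + 2) (2 ^ (n + 1)) t := by
        simpa using (((hasDerivAt_id t).sub_const 1).const_mul ((2 : ℝ) ^ (n + 1))).add_const 2
      have hs := ((contDiff_wiggleStep (d := q (n + 1) - q n)
        (e := (EuclideanSpace.single 0 1 : E2)) (a := a n) (k := k n)).differentiable one_ne_zero
        (2 ^ (n + 1) * (t - 1) + 2)).hasDerivAt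
      have := hs.scomp t hd
      rw [show (fun t : ℝ => wiggleStep (q (n + 1) - q n)
        (EuclideanSpace.single 0 1 : E2) (a n) (k n) (2 ^ (n + 1) * (t - 1) + 2)) =
        wiggleStep (q (n + 1) - q n) (EuclideanSpace.single 0 1 : E2) (a n) (k n) ∘
          fun t : ℝ => (2 : ℝ) ^ (n + 1) * (t - 1) + 2 from rfl, this.deriv, norm_smul,
        Real.norm_of_nonneg (by positivity)]
      have h1 := hCb (q (n + 1) - q n) (EuclideanSpace.single 0 1) (a n) (k n)
        (2 ^ (n + 1) * (t - 1) + 2) (ha n) (hk n) he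
      rw [hak n] at h1
      have h2 : C * (‖q (n + 1) - q n‖ + (1 / 8) ^ n) ≤ C * (3 * (1 / 8) ^ n) := by
        gcongr
        linarith [hq n]
      calc (2 : ℝ) ^ (n + 1) * _ ≤ 2 ^ (n + 1) * (C * (3 * (1 / 8) ^ n)) := by
            gcongr
            exact h1.trans h2
        _ = 6 * C * (2 * (1 / 8)) ^ n := by rw [mul_pow, pow_succ]; ring
        _ = 6 * C * (1 / 4) ^ n := by norm_num

lemma wiggleCurve_eq (hq0 : q 0 = 0) {n : ℕ} {t : ℝ} (h0 : 0 ≤ 2 ^ (n + 1) * (t - 1) + 2)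
    (h1 : 2 ^ (n + 1) * (t - 1) + 2 ≤ 1) :
    wiggleCurve q a k t = q n + wiggleStep (q (n + 1) - q n) (EuclideanSpace.single 0 1)
      (a n) (k n) (2 ^ (n + 1) * (t - 1) + 2) := by
  have hp : (0 : ℝ) < 2 ^ n := by positivity
  rw [wiggleCurve, tsum_eq_sum (s := Finset.range (n + 1)), Finset.sum_range_succ]
  · congr 1
    rw [← sub_zero (q n), ← hq0, ← Finset.sum_range_sub]
    refine Finset.sum_congr rfl fun m hm => ?_
    refine wiggleStep_of_one_le ?_
    have h2 : (2 : ℝ) ^ (m + 1) ≤ 2 ^ n :=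
      pow_le_pow_right₀ one_le_two (Finset.mem_range.1 hm)
    rw [pow_succ] at h0 h1
    nlinarith
  · intro m hm
    refine wiggleStep_of_le ?_
    have h2 : (2 : ℝ) ^ (n + 1) * 2 ≤ 2 ^ (m + 1) := by
      rw [← pow_succ]
      refine pow_le_pow_right₀ one_le_two ?_
      rw [Finset.mem_range] at hm
      omega
    have h3 : (0 : ℝ) < 2 ^ (n + 1) := by positivity
    nlinarith

lemma wiggleCurve_one {p : E2} (hq0 : q 0 = 0)
    (hq : ∀ n, ‖q (n + 1) - q n‖ ≤ 2 * (1 / 8) ^ n)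
    (hp : Filter.Tendsto q Filter.atTop (nhds p)) : wiggleCurve q a k 1 = p := by
  have h1 : ∀ n, wiggleStep (q (n + 1) - q n) (EuclideanSpace.single 0 1) (a n) (k n)
      (2 ^ (n + 1) * ((1 : ℝ) - 1) + 2) = q (n + 1) - q n := fun n =>
    wiggleStep_of_one_le (by norm_num)
  rw [wiggleCurve]
  simp_rw [h1]
  have hsum : Summable fun n => q (n + 1) - q n :=
    Summable.of_norm_bounded
      ((summable_geometric_of_lt_one (r := (1 / 8 : ℝ)) (by norm_num) (by norm_num)).mul_left 2) hq
  refine tendsto_nhds_unique hsum.hasSum.tendsto_sum_nat ?_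
  simp_rw [Finset.sum_range_sub, hq0, sub_zero]
  exact hp

lemma exists_dyadic_parameter {t : ℝ} (ht : t ∈ Set.Ico (0 : ℝ) 1) :
    ∃ n : ℕ, 0 ≤ 2 ^ (n + 1) * (t - 1) + 2 ∧ 2 ^ (n + 1) * (t - 1) + 2 ≤ 1 := by
  have h1 : 0 < 1 - t := by linarith [ht.2]
  obtain ⟨n, hn, hn'⟩ := exists_nat_pow_near (x := 1 / (1 - t)) (y := 2)
    ((one_le_div h1).2 (by linarith [ht.1])) one_lt_two
  rw [le_div_iff₀ h1] at hn
  rw [div_lt_iff₀ h1] at hn'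
  refine ⟨n, ?_, by linarith⟩
  rw [pow_succ]
  nlinarith

lemma wiggleCurve_mem_ball (hq0 : q 0 = 0) (hqb : ∀ n, q n ∈ ball (0 : E2) 1)
    (ha : ∀ n, 0 ≤ a n) (hab : ∀ n, closedBall (q n) (a n) ⊆ ball (0 : E2) 1)
    {t : ℝ} (ht : t ∈ Set.Ico (0 : ℝ) 1) : wiggleCurve q a k t ∈ ball (0 : E2) 1 := by
  obtain ⟨n, h0, h1⟩ := exists_dyadic_parameter ht
  rw [wiggleCurve_eq hq0 h0 h1]
  rcases le_total (2 ^ (n + 1) * (t - 1) + 2) (3 / 4) with h | h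
  · rw [wiggleStep_of_le_three_quarters h]
    refine hab n ?_
    rw [mem_closedBall, dist_eq_norm, add_sub_cancel_left]
    exact norm_wiggle_le (ha n) (by simp)
  · rw [wiggleStep_of_three_quarters_le h]
    exact (convex_ball (0 : E2) 1).add_smul_sub_mem (hqb n) (hqb (n + 1))
      ⟨smoothTransition.nonneg _, smoothTransition.le_one _⟩

lemma norm_deriv_wiggleCurve (hq0 : q 0 = 0) (ha : ∀ n, 0 ≤ a n) (hk : ∀ n, 1 ≤ k n) {n : ℕ} {t : ℝ}
    (ht : 2 ^ (n + 1) * (t - 1) + 2 ∈ Set.Ioo (1 / 4 : ℝ) (1 / 2)) :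
    ‖deriv (wiggleCurve q a k) t‖ = a n * k n * (2 * π * 2 ^ (n + 1)) *
      |cos (2 * π * k n * (2 ^ (n + 1) * (t - 1) + 2))| := by
  have hev : wiggleCurve q a k =ᶠ[nhds t] fun t => q n +
      (a n * sin (2 * π * k n * (2 ^ (n + 1) * (t - 1) + 2))) • EuclideanSpace.single 0 1 := by
    have hc : Continuous fun t : ℝ => (2 : ℝ) ^ (n + 1) * (t - 1) + 2 := by fun_prop
    filter_upwards [hc.continuousAt.preimage_mem_nhds (isOpen_Ioo.mem_nhds ht)] with u hu
    have hu' : 2 ^ (n + 1) * (u - 1) + 2 ∈ Set.Ioo (1 / 4 : ℝ) (1 / 2) := hu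
    rw [wiggleCurve_eq hq0 (by linarith [hu'.1]) (by linarith [hu'.2]),
      wiggleStep_of_mem ⟨hu'.1.le, hu'.2.le⟩]
  have hd : HasDerivAt (fun t : ℝ => 2 * π * k n * (2 ^ (n + 1) * (t - 1) + 2))
      (2 * π * k n * 2 ^ (n + 1)) t := by
    simpa using ((((hasDerivAt_id t).sub_const 1).const_mul ((2 : ℝ) ^ (n + 1))).add_const
      2).const_mul (2 * π * k n)
  have hd2 := (((hd.sin).const_mul (a n)).smul_const (EuclideanSpace.single 0 1 : E2)).const_add
    (q n)
  have hk0 : 0 ≤ k n := zero_le_one.trans (hk n)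
  rw [hev.deriv_eq, hd2.deriv, norm_smul, PiLp.norm_single, norm_one, mul_one, norm_mul,
    norm_mul, Real.norm_of_nonneg (ha n),
    Real.norm_of_nonneg (by positivity : 0 ≤ 2 * π * k n * 2 ^ (n + 1)), Real.norm_eq_abs]
  ring

end wiggleCurve

lemma integral_cos_sq_nat {k : ℕ} (hk : k ≠ 0) :
    ∫ s in (1 / 4 : ℝ)..(1 / 2), cos (2 * π * k * s) ^ 2 = 1 / 8 := by
  have hk' : (2 * π * k : ℝ) ≠ 0 := by positivity
  have := intervalIntegral.integral_comp_mul_left (a := 1 / 4) (b := 1 / 2)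
    (fun x => cos x ^ 2) hk'
  rw [this, integral_cos_sq, show 2 * π * (k : ℝ) * (1 / 2) = k * π by ring, sin_nat_mul_pi]
  have h2 : cos (2 * π * k * (1 / 4)) * sin (2 * π * k * (1 / 4)) = 0 := by
    have := sin_two_mul (2 * π * k * (1 / 4))
    rw [show 2 * (2 * π * (k : ℝ) * (1 / 4)) = k * π by ring, sin_nat_mul_pi] at this
    linarith
  rw [h2, smul_eq_mul]
  field_simp
  ring

/-- An oscillation of `wiggleCurve` in a region where `f ≥ L` contributes at least
`L * (a n * k n) / 2` to the `f`-length. -/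
lemma le_integral_wiggleCurve {q : ℕ → E2} {a : ℕ → ℝ} {k : ℕ → ℕ} {f : E2 → ℝ} {L : ℝ} {n : ℕ}
    (hq0 : q 0 = 0) (ha : ∀ n, 0 ≤ a n) (hk : ∀ n, 1 ≤ k n) (hL : 0 ≤ L)
    (hf : ∀ w ∈ closedBall (q n) (a n), L ≤ f w)
    (hf0 : ∀ t ∈ Set.Ioo (0 : ℝ) 1, 0 ≤ f (wiggleCurve q a (fun n => k n) t))
    (hgi : MeasureTheory.IntegrableOn (fun t => f (wiggleCurve q a (fun n => k n) t) *
      ‖deriv (wiggleCurve q a fun n => k n) t‖) (Set.Ioo 0 1)) :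
    L * (a n * k n) / 2 ≤ ∫ t in Set.Ioo (0 : ℝ) 1, f (wiggleCurve q a (fun n => k n) t) *
      ‖deriv (wiggleCurve q a fun n => k n) t‖ := by
  have hk1 : ∀ n, (1 : ℝ) ≤ k n := fun n => by exact_mod_cast hk n
  set P : ℝ := 2 ^ (n + 1) with hP
  have hPpos : 0 < P := by positivity
  have hP2 : 2 ≤ P := by
    rw [hP, pow_succ]
    linarith [one_le_pow₀ (one_le_two : (1 : ℝ) ≤ 2) (n := n)]
  set α : ℝ := 1 - (7 / 4) / P with hα
  set β : ℝ := 1 - (3 / 2) / P with hβ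
  have hαβ : α ≤ β := by
    have : 3 / 2 / P ≤ 7 / 4 / P := div_le_div_of_nonneg_right (by norm_num) hPpos.le
    rw [hα, hβ]
    linarith
  have hpar : ∀ t ∈ Set.Ioo α β, P * (t - 1) + 2 ∈ Set.Ioo (1 / 4 : ℝ) (1 / 2) := by
    rintro t ⟨h1, h2⟩
    have e1 : P * α = P - 7 / 4 := by rw [hα]; field_simp
    have e2 : P * β = P - 3 / 2 := by rw [hβ]; field_simp
    constructor <;> nlinarith
  have hsub : Set.Ioo α β ⊆ Set.Ioo 0 1 := by
    refine Set.Ioo_subset_Ioo ?_ ?_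
    · rw [hα, sub_nonneg, div_le_one hPpos]; linarith
    · rw [hβ]
      have : 0 < 3 / 2 / P := by positivity
      linarith
  have hcos : ∫ t in Set.Ioo α β, cos (2 * π * k n * (P * (t - 1) + 2)) ^ 2 = 1 / (8 * P) := by
    rw [← MeasureTheory.integral_Ioc_eq_integral_Ioo, ← intervalIntegral.integral_of_le hαβ]
    have h1 := intervalIntegral.integral_comp_mul_add (a := α) (b := β)
      (fun s => cos (2 * π * k n * s) ^ 2) hPpos.ne' (2 - P)
    have e1 : P * α + (2 - P) = 1 / 4 := by rw [hα]; field_simp; ring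
    have e2 : P * β + (2 - P) = 1 / 2 := by rw [hβ]; field_simp; ring
    rw [e1, e2, integral_cos_sq_nat (by have := hk n; omega)] at h1
    rw [show (fun t => cos (2 * π * k n * (P * (t - 1) + 2)) ^ 2) =
      fun t => cos (2 * π * k n * (P * t + (2 - P))) ^ 2 by ext t; ring_nf, h1, smul_eq_mul]
    field_simp
  calc L * (a n * k n) / 2
      ≤ L * (a n * k n * (2 * π * P)) * (1 / (8 * P)) := by
        have h1 : L * (a n * k n * (2 * π * P)) * (1 / (8 * P)) = L * (a n * k n) * (π / 4) := by
          field_simp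
          ring
        have h2 : 0 ≤ L * (a n * k n) :=
          mul_nonneg hL (mul_nonneg (ha n) (zero_le_one.trans (hk1 n)))
        rw [h1]
        nlinarith [pi_gt_three]
    _ = ∫ t in Set.Ioo α β, L * (a n * k n * (2 * π * P)) *
          cos (2 * π * k n * (P * (t - 1) + 2)) ^ 2 := by
        rw [MeasureTheory.integral_const_mul, hcos]
    _ ≤ ∫ t in Set.Ioo α β, f (wiggleCurve q a (fun n => k n) t) *
          ‖deriv (wiggleCurve q a fun n => k n) t‖ := by
        refine MeasureTheory.setIntegral_mono_on ?_ (hgi.mono_set hsub) measurableSet_Ioo ?_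
        · exact (Continuous.integrableOn_Icc (by fun_prop)).mono_set Set.Ioo_subset_Icc_self
        · intro t ht
          have hp := hpar t ht
          rw [norm_deriv_wiggleCurve hq0 ha hk1 hp, ← hP, mul_assoc L]
          refine mul_le_mul (hf _ ?_) ?_ ?_ (hL.trans (hf _ ?_))
          · rw [wiggleCurve_eq hq0 (n := n) (by linarith [hp.1]) (by linarith [hp.2]),
              wiggleStep_of_le_three_quarters (by linarith [hp.2]), mem_closedBall, dist_eq_norm,
              add_sub_cancel_left]
            exact norm_wiggle_le (ha n) (by simp)
          · have h3 : 0 ≤ a n * k n * (2 * π * P) :=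
              mul_nonneg (mul_nonneg (ha n) (zero_le_one.trans (hk1 n))) (by positivity)
            gcongr
            rw [← sq_abs]
            exact pow_le_of_le_one (abs_nonneg _) (abs_cos_le_one _) two_ne_zero
          · have := ha n
            positivity
          · rw [wiggleCurve_eq hq0 (n := n) (by linarith [hp.1]) (by linarith [hp.2]),
              wiggleStep_of_le_three_quarters (by linarith [hp.2]), mem_closedBall, dist_eq_norm,
              add_sub_cancel_left]
            exact norm_wiggle_le (ha n) (by simp)
    _ ≤ _ := by
        refine MeasureTheory.setIntegral_mono_set hgi ?_ hsub.eventuallyLE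
        filter_upwards [MeasureTheory.ae_restrict_mem measurableSet_Ioo] with t ht
        exact mul_nonneg (hf0 t ht) (norm_nonneg _)

/-- If a length element `f |dw|` is unbounded on the disc, some `C¹` curve from the center to the
boundary has infinite length. -/
lemma exists_contDiff_curve_not_integrableOn {f : E2 → ℝ} (hf : ContinuousOn f (ball 0 1))
    (hf0 : ∀ w ∈ ball (0 : E2) 1, 0 ≤ f w) (hunb : ∀ M, ∃ w ∈ ball (0 : E2) 1, M < f w) :
    ∃ γ : ℝ → E2, ContDiff ℝ 1 γ ∧ γ 0 = 0 ∧ ‖γ 1‖ = 1 ∧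
      (∀ t ∈ Set.Ico (0 : ℝ) 1, γ t ∈ ball (0 : E2) 1) ∧
      ¬ MeasureTheory.IntegrableOn (fun t => f (γ t) * ‖deriv γ t‖) (Set.Ioo 0 1) := by
  choose w hwb hw using fun n : ℕ => hunb n
  obtain ⟨p, hp, φ, hφ, hlim⟩ := tendsto_subseq_of_bounded isBounded_ball hwb
  have hfw : Filter.Tendsto (fun n => f (w (φ n))) Filter.atTop Filter.atTop :=
    Filter.tendsto_atTop_mono (fun n => (hw (φ n)).le)
      (tendsto_natCast_atTop_atTop.comp hφ.tendsto_atTop)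
  have hp1 : ‖p‖ = 1 := by
    rw [closure_ball _ one_ne_zero, mem_closedBall_zero_iff] at hp
    refine hp.antisymm (not_lt.1 fun h => ?_)
    have hpb : p ∈ ball (0 : E2) 1 := by simpa using h
    have := ((hf.continuousAt (isOpen_ball.mem_nhds hpb)).tendsto.comp hlim)
    exact not_tendsto_nhds_of_tendsto_atTop hfw _ this
  have hex : ∀ n : ℕ, ∃ z ∈ ball (0 : E2) 1, dist z p ≤ (1 / 8) ^ n ∧ 16 ^ n ≤ f z := by
    intro n
    have h1 : ∀ᶠ j in Filter.atTop, dist (w (φ j)) p ≤ (1 / 8) ^ n :=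
      hlim.eventually (closedBall_mem_nhds p (by positivity))
    obtain ⟨j, hj, hj'⟩ := (h1.and (hfw.eventually_ge_atTop (16 ^ n))).exists
    exact ⟨w (φ j), hwb _, hj, hj'⟩
  choose z hzb hzp hzf using hex
  set q : ℕ → E2 := fun n => if n = 0 then 0 else z n with hqdef
  have hq0 : q 0 = 0 := by simp [hqdef]
  have hqs : ∀ n, n ≠ 0 → q n = z n := fun n hn => by simp [hqdef, hn]
  have hqb : ∀ n, q n ∈ ball (0 : E2) 1 := by
    intro n
    by_cases hn : n = 0
    · simp [hn, hq0]
    · rw [hqs n hn]; exact hzb n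
  have hqp : Filter.Tendsto q Filter.atTop (nhds p) := by
    have hz : Filter.Tendsto z Filter.atTop (nhds p) := by
      rw [tendsto_iff_dist_tendsto_zero]
      exact squeeze_zero (fun _ => dist_nonneg) hzp
        (tendsto_pow_atTop_nhds_zero_of_lt_one (by norm_num) (by norm_num))
    refine hz.congr' ?_
    filter_upwards [Filter.eventually_ne_atTop 0] with n hn using (hqs n hn).symm
  have hqd : ∀ n, ‖q (n + 1) - q n‖ ≤ 2 * (1 / 8) ^ n := by
    intro n
    rw [hqs (n + 1) n.succ_ne_zero]
    by_cases hn : n = 0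
    · subst hn
      have := hzb 1
      rw [mem_ball_zero_iff] at this
      rw [hq0]
      simp only [zero_add, sub_zero, pow_zero]
      linarith
    · rw [hqs n hn, ← dist_eq_norm]
      refine (dist_triangle_right _ _ p).trans ?_
      have h1 := hzp (n + 1)
      have h2 := hzp n
      have h3 : (0 : ℝ) < (1 / 8) ^ n := by positivity
      rw [pow_succ] at h1
      linarith
  have hη : ∀ n, ∃ η > 0, closedBall (q n) η ⊆ ball (0 : E2) 1 ∩ {v | f (q n) - 1 / 2 ≤ f v} := by
    intro n
    refine nhds_basis_closedBall.mem_iff.1 (Filter.inter_mem (isOpen_ball.mem_nhds (hqb n)) ?_)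
    exact (hf.continuousAt (isOpen_ball.mem_nhds (hqb n))).eventually
      (Ici_mem_nhds (by linarith : f (q n) - 1 / 2 < f (q n)))
  choose η hη0 hηs using hη
  choose k hk using fun n => exists_nat_ge ((1 / 8) ^ n / η n)
  have hkpos : ∀ n, 1 ≤ k n := by
    intro n
    have h1 : (0 : ℝ) < (1 / 8) ^ n / η n := div_pos (by positivity) (hη0 n)
    exact_mod_cast h1.trans_le (hk n)
  have hkpos' : ∀ n, (0 : ℝ) < k n := fun n => by exact_mod_cast hkpos n
  set a : ℕ → ℝ := fun n => (1 / 8) ^ n / k n with hadef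
  have ha : ∀ n, 0 ≤ a n := fun n => div_nonneg (by positivity) (hkpos' n).le
  have haη : ∀ n, a n ≤ η n := by
    intro n
    have := hk n
    rw [div_le_iff₀ (hη0 n)] at this
    rw [hadef]
    simp only
    rw [div_le_iff₀ (hkpos' n)]
    linarith
  have hak : ∀ n, a n * k n = (1 / 8) ^ n := fun n => div_mul_cancel₀ _ (hkpos' n).ne'
  have hball : ∀ n, closedBall (q n) (a n) ⊆ ball (0 : E2) 1 := fun n =>
    (closedBall_subset_closedBall (haη n)).trans ((hηs n).trans Set.inter_subset_left)
  have hmem : ∀ t ∈ Set.Ico (0 : ℝ) 1, wiggleCurve q a (fun n => k n) t ∈ ball (0 : E2) 1 :=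
    fun t ht => wiggleCurve_mem_ball hq0 hqb ha hball ht
  refine ⟨wiggleCurve q a fun n => k n,
    contDiff_wiggleCurve hqd ha (fun n => by exact_mod_cast hkpos n) hak, ?_, ?_, hmem, ?_⟩
  · rw [wiggleCurve_eq hq0 (n := 0) (by norm_num) (by norm_num), hq0,
      wiggleStep_of_le (by norm_num), zero_add]
  · rw [wiggleCurve_one hq0 hqd hqp, hp1]
  · intro hgi
    obtain ⟨n, hn⟩ := pow_unbounded_of_one_lt (4 * ∫ t in Set.Ioo (0 : ℝ) 1,
      f (wiggleCurve q a (fun n => k n) t) * ‖deriv (wiggleCurve q a fun n => k n) t‖)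
      (one_lt_two : (1 : ℝ) < 2)
    have h1 : ∀ v ∈ closedBall (q (n + 1)) (a (n + 1)), (16 : ℝ) ^ (n + 1) / 2 ≤ f v := by
      intro v hv
      have h2 := (hηs (n + 1) (closedBall_subset_closedBall (haη _) hv)).2
      have h2' : f (q (n + 1)) - 1 / 2 ≤ f v := h2
      rw [hqs _ n.succ_ne_zero] at h2'
      have h3 := hzf (n + 1)
      have h4 : (1 : ℝ) ≤ 16 ^ (n + 1) := one_le_pow₀ (by norm_num)
      linarith
    have h2 := le_integral_wiggleCurve hq0 ha hkpos (by positivity) h1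
      (fun t ht => hf0 _ (hmem t ⟨ht.1.le, ht.2⟩)) hgi
    rw [hak] at h2
    have h3 : (16 : ℝ) ^ (n + 1) / 2 * (1 / 8) ^ (n + 1) / 2 = 2 ^ (n + 1) / 4 := by
      rw [show (16 : ℝ) ^ (n + 1) / 2 * (1 / 8) ^ (n + 1) / 2 =
        (16 ^ (n + 1) * (1 / 8) ^ (n + 1)) / 4 by ring, ← mul_pow]
      norm_num
    rw [h3] at h2
    have h4 : (2 : ℝ) ^ n ≤ 2 ^ (n + 1) := pow_le_pow_right₀ one_le_two n.le_succ
    linarith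

/-- The standard identification of `ℂ` with the parameter plane. -/
def planeEquiv : ℂ ≃ₗᵢ[ℝ] E2 := Complex.orthonormalBasisOneI.repr

lemma planeEquiv_eq (z : ℂ) : planeEquiv z =
    z.re • EuclideanSpace.single 0 1 + z.im • EuclideanSpace.single 1 1 := by
  ext i
  fin_cases i <;> simp [planeEquiv, Complex.orthonormalBasisOneI_repr_apply]

lemma planeEquiv_mem_ball {z : ℂ} : planeEquiv z ∈ ball (0 : E2) 1 ↔ z ∈ ball (0 : ℂ) 1 := by
  simp

lemma pd_eq (X : E2 → E4) (w v : E2) :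
    fderiv ℝ X w v = v 0 • pd X 0 w + v 1 • pd X 1 w := by
  rw [pd, pd, ← map_smul, ← map_smul, ← map_add]
  congr 1
  ext i
  fin_cases i <;> simp

section pd

variable {X : E2 → E4} {w : E2}

lemma differentiableAt_fderiv (hX : ContDiffAt ℝ 2 X w) :
    DifferentiableAt ℝ (fderiv ℝ X) w :=
  (hX.fderiv_right (m := 1) (by norm_num)).differentiableAt one_ne_zero

lemma differentiableAt_pd (hX : ContDiffAt ℝ 2 X w) (i : Fin 2) :
    DifferentiableAt ℝ (pd X i) w :=
  (differentiableAt_fderiv hX).clm_apply (differentiableAt_const _)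

lemma pd2_eq (hX : ContDiffAt ℝ 2 X w) (i j : Fin 2) :
    pd2 X i j w = fderiv ℝ (fderiv ℝ X) w (EuclideanSpace.single j 1)
      (EuclideanSpace.single i 1) := by
  have := (differentiableAt_fderiv hX).hasFDerivAt.clm_apply
    (hasFDerivAt_const (EuclideanSpace.single i (1 : ℝ)) w)
  rw [pd2, pd, show pd X i = fun y => fderiv ℝ X y (EuclideanSpace.single i 1) from rfl,
    this.fderiv]
  simp

lemma pd2_comm (hX : ContDiffAt ℝ 2 X w) : pd2 X 0 1 w = pd2 X 1 0 w := by
  rw [pd2_eq hX, pd2_eq hX]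
  exact (hX.isSymmSndFDerivAt (by simp)).eq _ _

end pd

/-- The component `X_u · e - i X_v · e` in direction `e` of the complex derivative of `X`. -/
def complexPd (X : E2 → E4) (e : E4) (z : ℂ) : ℂ :=
  (⟪pd X 0 (planeEquiv z), e⟫ : ℂ) - Complex.I * (⟪pd X 1 (planeEquiv z), e⟫ : ℂ)

lemma norm_complexPd_sq (X : E2 → E4) (e : E4) (z : ℂ) : ‖complexPd X e z‖ ^ 2 =
    ⟪pd X 0 (planeEquiv z), e⟫ ^ 2 + ⟪pd X 1 (planeEquiv z), e⟫ ^ 2 := by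
  rw [← Complex.normSq_eq_norm_sq, Complex.normSq_apply]
  simp [complexPd]
  ring

lemma hasDerivAt_complexPd {X : E2 → E4} {e : E4} {z : ℂ} (hX : ContDiffAt ℝ 2 X (planeEquiv z))
    (hΔ : pd2 X 0 0 (planeEquiv z) + pd2 X 1 1 (planeEquiv z) = 0) :
    HasDerivAt (complexPd X e) ((⟪pd2 X 0 0 (planeEquiv z), e⟫ : ℂ) -
      Complex.I * (⟪pd2 X 0 1 (planeEquiv z), e⟫ : ℂ)) z := by
  have hd : ∀ i, HasFDerivAt (fun z : ℂ => (⟪pd X i (planeEquiv z), e⟫ : ℂ))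
      (Complex.ofRealCLM ∘L (innerSL ℝ e) ∘L (fderiv ℝ (pd X i) (planeEquiv z)) ∘L
        (planeEquiv.toContinuousLinearEquiv : ℂ →L[ℝ] E2)) z := by
    intro i
    have h1 := (differentiableAt_pd hX i).hasFDerivAt.comp z
      (planeEquiv.toContinuousLinearEquiv : ℂ →L[ℝ] E2).hasFDerivAt
    have h2 := Complex.ofRealCLM.hasFDerivAt.comp z ((innerSL ℝ e).hasFDerivAt.comp z h1)
    refine h2.congr_of_eventuallyEq (Filter.Eventually.of_forall fun y => ?_)
    simp [real_inner_comm]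
  have h := (hd 0).sub ((hd 1).const_mul Complex.I)
  refine (hasFDerivAt_of_restrictScalars ℝ h (f' := ContinuousLinearMap.toSpanSingleton ℂ
    ((⟪pd2 X 0 0 (planeEquiv z), e⟫ : ℂ) - Complex.I * (⟪pd2 X 0 1 (planeEquiv z), e⟫ : ℂ)))
    ?_).hasDerivAt.congr_deriv (by simp)
  have h11 : pd2 X 1 1 (planeEquiv z) = -pd2 X 0 0 (planeEquiv z) := eq_neg_of_add_eq_zero_right hΔ
  have hpd : ∀ i v, fderiv ℝ (pd X i) (planeEquiv z) (planeEquiv v) =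
      v.re • pd2 X i 0 (planeEquiv z) + v.im • pd2 X i 1 (planeEquiv z) := by
    intro i v
    rw [pd_eq]
    simp [planeEquiv_eq, pd2]
  ext v
  simp [hpd, inner_add_right, inner_smul_right, ← pd2_comm hX, h11]
  simp only [real_inner_comm e]
  apply Complex.ext
  · simp
  · simp
    ring

/-- The length element of a conformal parametrization. -/
lemma norm_fderiv_of_conformal {X : E2 → E4} {w : E2} {W : ℝ} (h0 : ⟪pd X 0 w, pd X 0 w⟫ = W)
    (h1 : ⟪pd X 1 w, pd X 1 w⟫ = W) (h01 : ⟪pd X 0 w, pd X 1 w⟫ = 0) (v : E2) :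
    ‖fderiv ℝ X w v‖ = √W * ‖v‖ := by
  have hW : 0 ≤ W := h0 ▸ real_inner_self_nonneg
  rw [real_inner_self_eq_norm_sq] at h0 h1
  rw [← sq_eq_sq₀ (norm_nonneg _) (by positivity), mul_pow, sq_sqrt hW, pd_eq, norm_add_sq_real,
    norm_smul, norm_smul, mul_pow, mul_pow, h0, h1, inner_smul_left, inner_smul_right, h01,
    EuclideanSpace.norm_sq_eq]
  simp
  ring

/-- Bessel's inequality for an orthogonal pair of vectors of equal length. -/
lemma inner_sq_add_inner_sq_le {a b e : E4} {W : ℝ} (ha : ⟪a, a⟫ = W) (hb : ⟪b, b⟫ = W)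
    (hab : ⟪a, b⟫ = 0) (hW : 0 < W) (he : ‖e‖ = 1) : ⟪a, e⟫ ^ 2 + ⟪b, e⟫ ^ 2 ≤ W := by
  have h : 0 ≤ ⟪W • e - (⟪a, e⟫ • a + ⟪b, e⟫ • b), W • e - (⟪a, e⟫ • a + ⟪b, e⟫ • b)⟫ :=
    real_inner_self_nonneg
  have he' : ⟪e, e⟫ = 1 := by rw [real_inner_self_eq_norm_sq, he, one_pow]
  simp only [inner_sub_left, inner_sub_right, inner_add_left, inner_add_right,
    real_inner_smul_left, real_inner_smul_right, ha, hb, hab, real_inner_comm a e,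
    real_inner_comm b e, real_inner_comm a b, he'] at h
  nlinarith

/-- If all unit normals of the plane spanned by `a` and `b` make an angle of at least `ω` with the
unit vector `e`, then the projection of `e` to that plane has length at least `sin ω`. -/
lemma sin_sq_mul_le_inner_sq_add_inner_sq {a b e : E4} {W ω : ℝ} (ha : ⟪a, a⟫ = W)
    (hb : ⟪b, b⟫ = W) (hab : ⟪a, b⟫ = 0) (hW : 0 < W) (he : ‖e‖ = 1)
    (hN : ∀ N : E4, ‖N‖ = 1 → ⟪N, a⟫ = 0 → ⟪N, b⟫ = 0 → |⟪N, e⟫| ≤ cos ω) :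
    sin ω ^ 2 * W ≤ ⟪a, e⟫ ^ 2 + ⟪b, e⟫ ^ 2 := by
  set n : E4 := e - ((⟪a, e⟫ / W) • a + (⟪b, e⟫ / W) • b) with hn
  have he' : ⟪e, e⟫ = 1 := by rw [real_inner_self_eq_norm_sq, he, one_pow]
  have hba : ⟪b, a⟫ = 0 := by rw [real_inner_comm, hab]
  have hna : ⟪n, a⟫ = 0 := by
    rw [hn, inner_sub_left, inner_add_left, real_inner_smul_left, real_inner_smul_left, ha, hba,
      real_inner_comm a e]
    field_simp
    ring
  have hnb : ⟪n, b⟫ = 0 := by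
    rw [hn, inner_sub_left, inner_add_left, real_inner_smul_left, real_inner_smul_left, hb, hab,
      real_inner_comm b e]
    field_simp
    ring
  have hne : ⟪n, e⟫ = 1 - (⟪a, e⟫ ^ 2 + ⟪b, e⟫ ^ 2) / W := by
    rw [hn, inner_sub_left, inner_add_left, real_inner_smul_left, real_inner_smul_left, he']
    ring
  have hnn : ‖n‖ ^ 2 = ⟪n, e⟫ := by
    rw [← real_inner_self_eq_norm_sq]
    nth_rewrite 2 [hn]
    rw [inner_sub_right, inner_add_right, real_inner_smul_right, real_inner_smul_right, hna, hnb]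
    ring
  have hkey : ‖n‖ ^ 2 ≤ cos ω ^ 2 := by
    by_cases h0 : n = 0
    · rw [h0]
      simpa using sq_nonneg (cos ω)
    · have hpos : 0 < ‖n‖ := norm_pos_iff.2 h0
      have := hN (‖n‖⁻¹ • n) (norm_smul_inv_norm h0) (by rw [real_inner_smul_left, hna, mul_zero])
        (by rw [real_inner_smul_left, hnb, mul_zero])
      rw [real_inner_smul_left, ← hnn, pow_two, inv_mul_cancel_left₀ hpos.ne', abs_norm] at this
      gcongr
  rw [hnn, hne, cos_sq', sub_le_sub_iff_left, le_div_iff₀ hW] at hkey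
  exact hkey

/-- Curvature bound at the center of a minimal surface in terms of a bound from below for one
component of its complex derivative. -/
lemma curvature_le_of_norm_complexPd {X : E2 → E4} {W : E2 → ℝ} {s : ℝ} {e N : E4} (hs : 0 < s)
    (hX : ContDiffOn ℝ 2 X (ball 0 1))
    (hΔ : ∀ w ∈ ball (0 : E2) 1, pd2 X 0 0 w + pd2 X 1 1 w = 0)
    (hW : ∀ w ∈ ball (0 : E2) 1, ⟪pd X 0 w, pd X 0 w⟫ = W w ∧ ⟪pd X 1 w, pd X 1 w⟫ = W w ∧
      ⟪pd X 0 w, pd X 1 w⟫ = 0 ∧ 0 < W w)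
    (hs_le : ∀ z ∈ ball (0 : ℂ) 1, s * √(W (planeEquiv z)) ≤ ‖complexPd X e z‖)
    (hN : ‖N‖ = 1) (hN0 : ⟪N, pd X 0 0⟫ = 0) (hN1 : ⟪N, pd X 1 0⟫ = 0) :
    -2 * ((⟪pd2 X 0 0 0, N⟫ * ⟪pd2 X 1 1 0, N⟫ - ⟪pd2 X 0 1 0, N⟫ ^ 2) / W 0 ^ 2) ≤
      8 * ‖complexPd X e 0‖ ^ 2 / (s ^ 2 * W 0 ^ 2) := by
  have hat : ∀ z ∈ ball (0 : ℂ) 1, ∀ e, HasDerivAt (complexPd X e)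
      ((⟪pd2 X 0 0 (planeEquiv z), e⟫ : ℂ) - Complex.I * (⟪pd2 X 0 1 (planeEquiv z), e⟫ : ℂ)) z :=
    fun z hz e => hasDerivAt_complexPd
      (hX.contDiffAt (isOpen_ball.mem_nhds (planeEquiv_mem_ball.2 hz)))
      (hΔ _ (planeEquiv_mem_ball.2 hz))
  have hpos : ∀ z ∈ ball (0 : ℂ) 1, 0 < √(W (planeEquiv z)) := fun z hz =>
    sqrt_pos.2 (hW _ (planeEquiv_mem_ball.2 hz)).2.2.2
  have hne : ∀ z ∈ ball (0 : ℂ) 1, complexPd X e z ≠ 0 := fun z hz =>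
    norm_pos_iff.1 ((mul_pos hs (hpos z hz)).trans_le (hs_le z hz))
  have h0 : (0 : ℂ) ∈ ball (0 : ℂ) 1 := mem_ball_self one_pos
  have hN00 : complexPd X N 0 = 0 := by
    simp [complexPd, real_inner_comm N, hN0, hN1]
  have hsub : closedBall (0 : ℂ) (1 / 2) ⊆ ball 0 1 := closedBall_subset_ball (by norm_num)
  have hder := (hat 0 h0 N).div (hat 0 h0 e) (hne 0 h0)
  have hcauchy : ‖deriv (complexPd X N / complexPd X e) 0‖ ≤ 1 / s / (1 / 2) := by
    refine Complex.norm_deriv_le_of_forall_mem_sphere_norm_le (by norm_num) ?_ fun z hz => ?_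
    · refine DifferentiableOn.diffContOnCl fun z hz => ?_
      rw [closure_ball _ (by norm_num)] at hz
      exact ((hat z (hsub hz) N).div (hat z (hsub hz) e)
        (hne z (hsub hz))).differentiableAt.differentiableWithinAt
    · have hz' := hsub (sphere_subset_closedBall hz)
      obtain ⟨ha, hb, hab, hWp⟩ := hW _ (planeEquiv_mem_ball.2 hz')
      rw [Pi.div_apply, norm_div, div_le_div_iff₀ (norm_pos_iff.2 (hne z hz')) hs, one_mul]
      refine le_trans ?_ (hs_le z hz')
      rw [mul_comm]
      gcongr
      refine le_sqrt_of_sq_le ?_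
      rw [norm_complexPd_sq]
      exact inner_sq_add_inner_sq_le ha hb hab hWp hN
  obtain ⟨-, -, -, hWp⟩ := hW 0 (mem_ball_self one_pos)
  rw [hder.deriv, hN00, zero_mul, sub_zero, map_zero, norm_div, norm_mul, norm_pow, pow_two,
    mul_div_mul_right _ _ (norm_ne_zero_iff.2 (hne 0 h0)), div_le_iff₀
    (norm_pos_iff.2 (hne 0 h0))] at hcauchy
  set Z : ℂ := (⟪pd2 X 0 0 0, N⟫ : ℂ) - Complex.I * (⟪pd2 X 0 1 0, N⟫ : ℂ) with hZ
  have hZn : ‖Z‖ ^ 2 = ⟪pd2 X 0 0 0, N⟫ ^ 2 + ⟪pd2 X 0 1 0, N⟫ ^ 2 := by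
    rw [← Complex.normSq_eq_norm_sq, Complex.normSq_apply]
    simp [hZ]
    ring
  rw [eq_neg_of_add_eq_zero_right (hΔ 0 (mem_ball_self one_pos)), inner_neg_left]
  calc _ = 2 * ‖Z‖ ^ 2 / W 0 ^ 2 := by rw [hZn]; ring
    _ ≤ 2 * (1 / s / (1 / 2) * ‖complexPd X e 0‖) ^ 2 / W 0 ^ 2 := by gcongr
    _ = _ := by field_simp; ring

section length

variable {X : E2 → E4} {W : E2 → ℝ} {γ : ℝ → E2} {r : ℝ}

lemma integral_norm_deriv_comp (hX : ContDiffOn ℝ 2 X (ball 0 1))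
    (hW : ∀ w ∈ ball (0 : E2) 1, ⟪pd X 0 w, pd X 0 w⟫ = W w ∧ ⟪pd X 1 w, pd X 1 w⟫ = W w ∧
      ⟪pd X 0 w, pd X 1 w⟫ = 0 ∧ 0 < W w)
    (hγ : ContDiff ℝ 1 γ) (hγb : ∀ t ∈ Set.Ico (0 : ℝ) 1, γ t ∈ ball (0 : E2) 1) :
    ∫ t in (0 : ℝ)..1, ‖deriv (X ∘ γ) t‖ =
      ∫ t in Set.Ioo (0 : ℝ) 1, √(W (γ t)) * ‖deriv γ t‖ := by
  rw [intervalIntegral.integral_of_le zero_le_one, MeasureTheory.integral_Ioc_eq_integral_Ioo]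
  refine MeasureTheory.setIntegral_congr_fun measurableSet_Ioo fun t ht => ?_
  have hb := hγb t ⟨ht.1.le, ht.2⟩
  obtain ⟨h0, h1, h01, -⟩ := hW _ hb
  have h2 := ((hX.contDiffAt (isOpen_ball.mem_nhds hb)).differentiableAt two_ne_zero).hasFDerivAt
  rw [(h2.comp_hasDerivAt t (hγ.differentiable one_ne_zero t).hasDerivAt).deriv,
    norm_fderiv_of_conformal h0 h1 h01]

lemma integrableOn_of_pos_le (hr : 0 < r) {g : ℝ → ℝ} (h : r ≤ ∫ t in Set.Ioo (0 : ℝ) 1, g t) :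
    MeasureTheory.IntegrableOn g (Set.Ioo 0 1) := by
  by_contra hg
  rw [MeasureTheory.integral_undef hg] at h
  linarith

/-- If curves from the center to the boundary have length at least `r > 0` (in the sense of the
Bochner integral, hence have finite length), then the conformal factor is bounded. -/
lemma exists_sqrt_le (hr : 0 < r) (hX : ContDiffOn ℝ 2 X (ball 0 1))
    (hW : ∀ w ∈ ball (0 : E2) 1, ⟪pd X 0 w, pd X 0 w⟫ = W w ∧ ⟪pd X 1 w, pd X 1 w⟫ = W w ∧
      ⟪pd X 0 w, pd X 1 w⟫ = 0 ∧ 0 < W w) (hWc : ContinuousOn W (ball 0 1))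
    (hL : ∀ γ : ℝ → E2, ContDiff ℝ 1 γ →
      (∀ t ∈ Set.Icc (0 : ℝ) 1, γ t ∈ closedBall (0 : E2) 1) →
      γ 0 = 0 → ‖γ 1‖ = 1 → r ≤ ∫ t in (0 : ℝ)..1, ‖deriv (X ∘ γ) t‖) :
    ∃ M, ∀ w ∈ ball (0 : E2) 1, √(W w) ≤ M := by
  by_contra! hcon
  obtain ⟨γ, hγ, hγ0, hγ1, hγb, hγi⟩ := exists_contDiff_curve_not_integrableOn
    (f := fun w => √(W w)) hWc.sqrt (fun _ _ => sqrt_nonneg _) hcon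
  have := hL γ hγ (fun t ht => ?_) hγ0 hγ1
  · rw [integral_norm_deriv_comp hX hW hγ hγb] at this
    exact hγi (integrableOn_of_pos_le hr this)
  · rcases ht.2.eq_or_lt with rfl | h
    · simp [hγ1]
    · exact ball_subset_closedBall (hγb t ⟨ht.1, h⟩)

lemma le_lintegral_radius (hr : 0 < r) (hX : ContDiffOn ℝ 2 X (ball 0 1))
    (hW : ∀ w ∈ ball (0 : E2) 1, ⟪pd X 0 w, pd X 0 w⟫ = W w ∧ ⟪pd X 1 w, pd X 1 w⟫ = W w ∧
      ⟪pd X 0 w, pd X 1 w⟫ = 0 ∧ 0 < W w)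
    (hL : ∀ γ : ℝ → E2, ContDiff ℝ 1 γ →
      (∀ t ∈ Set.Icc (0 : ℝ) 1, γ t ∈ closedBall (0 : E2) 1) →
      γ 0 = 0 → ‖γ 1‖ = 1 → r ≤ ∫ t in (0 : ℝ)..1, ‖deriv (X ∘ γ) t‖) (θ : ℝ) :
    ENNReal.ofReal r ≤
      ∫⁻ ρ in Set.Ioo (0 : ℝ) 1, ENNReal.ofReal √(W (planeEquiv (circleMap 0 ρ θ))) := by
  set v : E2 := planeEquiv (circleMap 0 1 θ) with hv
  have hv1 : ‖v‖ = 1 := by simp [hv]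
  have hcm : ∀ ρ : ℝ, planeEquiv (circleMap 0 ρ θ) = ρ • v := by
    intro ρ
    rw [hv, ← map_smul]
    simp [circleMap]
  have hγ : ContDiff ℝ 1 fun t : ℝ => t • v := contDiff_id.smul contDiff_const
  have hd : ∀ t : ℝ, ‖deriv (fun t : ℝ => t • v) t‖ = 1 := by
    intro t
    have := ((hasDerivAt_id t).smul_const v).deriv
    simp only [id_eq, one_smul] at this
    rw [this, hv1]
  have hn : ∀ t : ℝ, 0 ≤ t → ‖t • v‖ = t := fun t ht => by
    rw [norm_smul, hv1, mul_one, Real.norm_of_nonneg ht]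
  have h := hL (fun t => t • v) hγ (fun t ht => by simpa [hn t ht.1] using ht.2) (by simp)
    (by simp [hv1])
  rw [integral_norm_deriv_comp hX hW hγ (fun t ht => by simpa [hn t ht.1] using ht.2)] at h
  have hi := integrableOn_of_pos_le hr h
  simp only [hd, mul_one] at h hi
  simp only [hcm]
  rw [← MeasureTheory.ofReal_integral_eq_lintegral_ofReal hi
    (Filter.Eventually.of_forall fun _ => sqrt_nonneg _)]
  exact ENNReal.ofReal_le_ofReal h

end length

lemma continuousOn_pd {X : E2 → E4} (hX : ContDiffOn ℝ 2 X (ball 0 1)) (i : Fin 2) :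
    ContinuousOn (pd X i) (ball 0 1) := fun _ hw =>
  (differentiableAt_pd (hX.contDiffAt (isOpen_ball.mem_nhds hw)) i).continuousAt.continuousWithinAt

/-- Transport of the energy bound to the complex disc. -/
lemma lintegral_sqrt_sq_le {X : E2 → E4} {W : E2 → ℝ} {E M : ℝ}
    (hX : ContDiffOn ℝ 2 X (ball 0 1))
    (hW : ∀ w ∈ ball (0 : E2) 1, ⟪pd X 0 w, pd X 0 w⟫ = W w ∧ ⟪pd X 1 w, pd X 1 w⟫ = W w ∧
      ⟪pd X 0 w, pd X 1 w⟫ = 0 ∧ 0 < W w)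
    (hM : ∀ w ∈ ball (0 : E2) 1, √(W w) ≤ M)
    (hE : ∫ w in ball (0 : E2) 1, (‖pd X 0 w‖ ^ 2 + ‖pd X 1 w‖ ^ 2) ≤ E) :
    ∫⁻ z in ball (0 : ℂ) 1, ENNReal.ofReal (√(W (planeEquiv z)) ^ 2) ≤ ENNReal.ofReal E := by
  have hgi : MeasureTheory.IntegrableOn (fun w => ‖pd X 0 w‖ ^ 2 + ‖pd X 1 w‖ ^ 2)
      (ball (0 : E2) 1) := by
    have : Fact (MeasureTheory.volume (ball (0 : E2) 1) < ⊤) :=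
      ⟨MeasureTheory.measure_ball_lt_top⟩
    refine ⟨(((continuousOn_pd hX 0).norm.pow 2).add
      ((continuousOn_pd hX 1).norm.pow 2)).aestronglyMeasurable measurableSet_ball, ?_⟩
    refine MeasureTheory.HasFiniteIntegral.of_bounded (C := 2 * M ^ 2) ?_
    filter_upwards [MeasureTheory.ae_restrict_mem measurableSet_ball] with w hw
    obtain ⟨h0, h1, -, hp⟩ := hW w hw
    rw [real_inner_self_eq_norm_sq] at h0 h1
    rw [h0, h1, Real.norm_of_nonneg (by positivity), ← two_mul]
    have := pow_le_pow_left₀ (sqrt_nonneg _) (hM w hw) 2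
    rw [sq_sqrt hp.le] at this
    linarith
  have htr := planeEquiv.measurePreserving.setLIntegral_comp_preimage_emb
    planeEquiv.toHomeomorph.measurableEmbedding (fun w => ENNReal.ofReal (√(W w) ^ 2))
    (ball (0 : E2) 1)
  have hpre : planeEquiv ⁻¹' ball (0 : E2) 1 = ball (0 : ℂ) 1 := Set.ext fun _ =>
    planeEquiv_mem_ball
  rw [hpre] at htr
  rw [htr]
  refine le_trans ?_ (ENNReal.ofReal_le_ofReal hE)
  rw [MeasureTheory.ofReal_integral_eq_lintegral_ofReal hgi
    (Filter.Eventually.of_forall fun _ => by positivity)]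
  refine MeasureTheory.setLIntegral_mono' measurableSet_ball fun w hw => ?_
  obtain ⟨h0, -, -, hp⟩ := hW w hw
  rw [real_inner_self_eq_norm_sq] at h0
  rw [sq_sqrt hp.le, ← h0]
  exact ENNReal.ofReal_le_ofReal (by linarith [sq_nonneg ‖pd X 1 w‖])

/-- **Curvature estimate for minimal graphs in `ℝ⁴`.** For a harmonic, conformally
parametrized minimal graph representing a geodesic disc of radius `r` centered at the
origin, with Dirichlet energy at most `d₀r²`, all of whose normals make an angle of at
least `ω` with the `x¹`-axis, there is a constant `Θ = Θ(d₀, sin ω)` such that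
`κ₁² + κ₂² = −2K ≤ Θ/r²` at the center, for every normal direction `N` there. -/
theorem curvature_estimate_minimal_graph_R4
    (ω : ℝ) (hω : ω ∈ Set.Ioc 0 (π / 2))
    (d₀ : ℝ) (hd₀ : 0 < d₀) :
    ∃ Θ : ℝ, 0 < Θ ∧
      ∀ (r : ℝ), 0 < r →
      ∀ (X : E2 → E4) (W : E2 → ℝ),
        ContDiffOn ℝ 2 X (ball (0 : E2) 1) →
        ContinuousOn X (closedBall (0 : E2) 1) →
        -- harmonicity ΔX = 0
        (∀ w ∈ ball (0 : E2) 1, pd2 X 0 0 w + pd2 X 1 1 w = 0) →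
        -- conformal parametrization with area element W
        (∀ w ∈ ball (0 : E2) 1,
          ⟪pd X 0 w, pd X 0 w⟫ = W w ∧ ⟪pd X 1 w, pd X 1 w⟫ = W w ∧
          ⟪pd X 0 w, pd X 1 w⟫ = 0 ∧ 0 < W w) →
        -- conformal reparametrization of a positively oriented graph
        Set.InjOn (fun w => (X w 0, X w 1)) (ball (0 : E2) 1) →
        (∀ w ∈ ball (0 : E2) 1,
          0 < pdR (fun w' => X w' 0) 0 w * pdR (fun w' => X w' 1) 1 w
              - pdR (fun w' => X w' 0) 1 w * pdR (fun w' => X w' 1) 0 w) →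
        (∃ φ ψ : ℝ × ℝ → ℝ, ContDiff ℝ 2 φ ∧ ContDiff ℝ 2 ψ ∧
          ∀ w ∈ ball (0 : E2) 1,
            X w 2 = φ (X w 0, X w 1) ∧ X w 3 = ψ (X w 0, X w 1)) →
        -- geodesic disc of radius r with center X(0,0) = 0
        X 0 = 0 →
        (∀ γ : ℝ → E2, ContDiff ℝ 1 γ →
          (∀ t ∈ Set.Icc (0 : ℝ) 1, γ t ∈ closedBall (0 : E2) 1) →
          γ 0 = 0 → ‖γ 1‖ = 1 →
          r ≤ ∫ t in (0 : ℝ)..1, ‖deriv (X ∘ γ) t‖) →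
        -- Dirichlet energy bound
        (∫ w in ball (0 : E2) 1, (‖pd X 0 w‖ ^ 2 + ‖pd X 1 w‖ ^ 2)) ≤ d₀ * r ^ 2 →
        -- all normals make an angle of at least ω with the x¹-axis
        (∀ w ∈ ball (0 : E2) 1, ∀ N : E4, ‖N‖ = 1 →
          ⟪N, pd X 0 w⟫ = 0 → ⟪N, pd X 1 w⟫ = 0 →
          |⟪N, EuclideanSpace.single (0 : Fin 4) 1⟫| ≤ Real.cos ω) →
      ∀ N : E4, ‖N‖ = 1 → ⟪N, pd X 0 0⟫ = 0 → ⟪N, pd X 1 0⟫ = 0 →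
        -2 * ((⟪pd2 X 0 0 0, N⟫ * ⟪pd2 X 1 1 0, N⟫ - ⟪pd2 X 0 1 0, N⟫ ^ 2)
            / W 0 ^ 2) ≤ Θ / r ^ 2 := by
  have hsin : 0 < sin ω := sin_pos_of_pos_of_lt_pi hω.1 (by linarith [hω.2, pi_pos])
  obtain ⟨c, hc, hcr⟩ := exists_mul_le_norm_zero hd₀ hsin
  refine ⟨8 / (sin ω ^ 2 * c ^ 2), by positivity, ?_⟩
  intro r hr X W hX _ hΔ hW _ _ _ _ hL hE hang N hN hN0 hN1
  set e : E4 := EuclideanSpace.single 0 1 with he_def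
  have he : ‖e‖ = 1 := by simp [he_def]
  have hWc : ContinuousOn W (ball 0 1) := by
    refine (((continuousOn_pd hX 0).norm.pow 2)).congr fun w hw => ?_
    rw [← (hW w hw).1, real_inner_self_eq_norm_sq, Pi.pow_apply]
  have hb : ∀ z ∈ ball (0 : ℂ) 1, sin ω * √(W (planeEquiv z)) ≤ ‖complexPd X e z‖ ∧
      ‖complexPd X e z‖ ≤ √(W (planeEquiv z)) := by
    intro z hz
    have hw := planeEquiv_mem_ball.2 hz
    obtain ⟨h0, h1, h01, hp⟩ := hW _ hw
    constructor
    · refine le_of_sq_le_sq ?_ (norm_nonneg _)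
      rw [mul_pow, sq_sqrt hp.le, norm_complexPd_sq]
      exact sin_sq_mul_le_inner_sq_add_inner_sq h0 h1 h01 hp he (hang _ hw)
    · refine le_sqrt_of_sq_le ?_
      rw [norm_complexPd_sq]
      exact inner_sq_add_inner_sq_le h0 h1 h01 hp he
  obtain ⟨M, hM⟩ := exists_sqrt_le hr hX hW hWc hL
  have hlow := hcr r hr (complexPd X e) (fun z => √(W (planeEquiv z)))
    (fun z hz => (hasDerivAt_complexPd
      (hX.contDiffAt (isOpen_ball.mem_nhds (planeEquiv_mem_ball.2 hz)))
      (hΔ _ (planeEquiv_mem_ball.2 hz))).differentiableAt.differentiableWithinAt)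
    (fun z hz => norm_pos_iff.1 ((mul_pos hsin
      (sqrt_pos.2 (hW _ (planeEquiv_mem_ball.2 hz)).2.2.2)).trans_le (hb z hz).1))
    (hWc.sqrt.comp planeEquiv.continuous.continuousOn fun z hz => planeEquiv_mem_ball.2 hz) hb
    (lintegral_sqrt_sq_le hX hW hM hE) (le_lintegral_radius hr hX hW hL)
  have hWp := (hW 0 (mem_ball_self one_pos)).2.2.2
  have hup : ‖complexPd X e 0‖ ^ 2 ≤ W 0 := by
    have := pow_le_pow_left₀ (norm_nonneg _) (hb 0 (mem_ball_self one_pos)).2 2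
    rwa [map_zero, sq_sqrt hWp.le] at this
  have hWr : (c * r) ^ 2 ≤ W 0 := (pow_le_pow_left₀ (by positivity) hlow 2).trans hup
  calc _ ≤ 8 * ‖complexPd X e 0‖ ^ 2 / (sin ω ^ 2 * W 0 ^ 2) :=
        curvature_le_of_norm_complexPd hsin hX hΔ hW (fun z hz => (hb z hz).1) hN hN0 hN1
    _ ≤ 8 * W 0 / (sin ω ^ 2 * W 0 ^ 2) := by gcongr
    _ = 8 / (sin ω ^ 2 * W 0) := by field_simp
    _ ≤ 8 / (sin ω ^ 2 * (c * r) ^ 2) := by gcongr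
    _ = 8 / (sin ω ^ 2 * c ^ 2) / r ^ 2 := by field_simp
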